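/- Let Φ be a C^∞ map of the form (2) and let N ≥ 100 be given. Then there exist positive constants δ_N, C_N and a function F_N of class C^N on [0, δ_N] such that: (I) Tangency: |F_N(x)| ≤ C_N x³ for x ∈ [0, δ_N]; (II) Invariance: for every x̄ ∈ [0, δ_N] there exists x̂ ∈ [0, x̄] such that (x̄, F_N(x̄)) = Φ(x̂, F_N(x̂)). -/

import Mathlib

open Set Filter Asymptotics Topology
open scoped ContDiff

section Taylor
variable {E : Type*} [NormedAddCommGroup E] [NormedSpace ℝ E]

/-- Integrating an order-of-vanishing estimate. -/
theorem isBigO_pow_succ_of_deriv {e : ℝ → E} {k : ℕ}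
    (hd : ∀ᶠ s in 𝓝 (0 : ℝ), DifferentiableAt ℝ e s) (h0 : e 0 = 0)
    (h : deriv e =O[𝓝 0] fun s : ℝ => s ^ k) :
    e =O[𝓝 0] fun s : ℝ => s ^ (k + 1) := by
  obtain ⟨C, hC⟩ := h.bound
  obtain ⟨r, hr, hball⟩ := Metric.eventually_nhds_iff_ball.1 (hd.and hC)
  refine IsBigO.of_bound C ?_
  filter_upwards [Metric.ball_mem_nhds (0 : ℝ) hr] with s hs
  have hsub : ∀ t ∈ Metric.closedBall (0 : ℝ) |s|, t ∈ Metric.ball (0 : ℝ) r := by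
    intro t ht
    simp only [Metric.mem_closedBall, Metric.mem_ball, dist_zero_right, Real.norm_eq_abs] at *
    linarith
  have key := (convex_closedBall (0 : ℝ) |s|).norm_image_sub_le_of_norm_deriv_le
    (f := e) (C := C * |s| ^ k) (x := 0) (y := s)
    (fun t ht => (hball t (hsub t ht)).1)
    (fun t ht => by
      refine (hball t (hsub t ht)).2.trans ?_
      have hC0 : 0 ≤ C ∨ C < 0 := le_or_gt 0 C
      have ht' : |t| ≤ |s| := by simpa using ht
      rw [norm_pow, Real.norm_eq_abs]
      rcases hC0 with hC0 | hC0
      · gcongr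
      · have h1 := (norm_nonneg _).trans (hball t (hsub t ht)).2
        have h2 := (norm_nonneg _).trans (hball s hs).2
        rw [norm_pow, Real.norm_eq_abs] at h1 h2
        have h3 : |t| ^ k ≤ 0 := by nlinarith
        have h4 : |s| ^ k ≤ 0 := by nlinarith
        have h5 : 0 ≤ |t| ^ k := by positivity
        have h6 : 0 ≤ |s| ^ k := by positivity
        rw [le_antisymm h3 h5, le_antisymm h4 h6])
    (by simp) (by simp)
  simpa [h0, pow_succ, mul_assoc] using key

theorem ContDiffAt.eventually_differentiableAt {F : Type*} [NormedAddCommGroup F]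
    [NormedSpace ℝ F] {f : F → E} {x : F} (h : ContDiffAt ℝ ∞ f x) :
    ∀ᶠ y in 𝓝 x, DifferentiableAt ℝ f y := by
  have h1 : ContDiffAt ℝ 1 f x := h.of_le (by exact_mod_cast le_top)
  filter_upwards [h1.eventually (by simp)] with y hy
  exact hy.differentiableAt (by simp)

theorem ContDiffAt.deriv_infty {e : ℝ → E} {x : ℝ} (h : ContDiffAt ℝ ∞ e x) :
    ContDiffAt ℝ ∞ (deriv e) x := by
  have h1 : ContDiffAt ℝ ∞ (fderiv ℝ e) x := h.fderiv_right (by simp)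
  have : deriv e = fun t => fderiv ℝ e t 1 := by
    ext t; simp
  rw [this]
  exact h1.clm_apply contDiffAt_const

theorem isBigO_pow_of_le {k l : ℕ} (hkl : k ≤ l) :
    (fun s : ℝ => s ^ l) =O[𝓝 0] fun s : ℝ => s ^ k := by
  refine IsBigO.of_bound 1 ?_
  filter_upwards [Metric.ball_mem_nhds (0 : ℝ) one_pos] with s hs
  have hs' : |s| ≤ 1 := by simpa using (Metric.mem_ball.1 hs).le
  simpa using pow_le_pow_of_le_one (abs_nonneg s) hs' hkl

theorem eq_zero_of_pow_smul_isBigO {k : ℕ} {c : E}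
    (h : (fun s : ℝ => s ^ k • c) =O[𝓝 0] fun s : ℝ => s ^ (k + 1)) : c = 0 := by
  obtain ⟨C, hC⟩ := h.bound
  have h1 : ∀ᶠ s : ℝ in 𝓝[>] 0, ‖c‖ ≤ C * s := by
    filter_upwards [hC.filter_mono nhdsWithin_le_nhds, self_mem_nhdsWithin] with s hs hs0
    have hs0' : (0 : ℝ) < s := hs0
    rw [norm_smul, norm_pow, norm_pow, Real.norm_eq_abs, abs_of_pos hs0', pow_succ] at hs
    have : 0 < s ^ k := by positivity
    nlinarith
  have h2 : Tendsto (fun s : ℝ => C * s) (𝓝[>] 0) (𝓝 0) := by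
    have : Tendsto (fun s : ℝ => C * s) (𝓝 0) (𝓝 (C * 0)) := (continuous_const_mul C).tendsto 0
    rw [mul_zero] at this
    exact this.mono_left nhdsWithin_le_nhds
  have := ge_of_tendsto h2 h1
  exact norm_le_zero_iff.1 this

/-- Taylor expansion at the first nonvanishing order, for a smooth function vanishing to
order `k`, together with the vanishing order of its derivative. -/
theorem taylor_of_isBigO (k : ℕ) :
    (∀ e : ℝ → E, ContDiffAt ℝ ∞ e 0 → (e =O[𝓝 0] fun s : ℝ => s ^ (k + 1)) →
      deriv e =O[𝓝 0] fun s : ℝ => s ^ k) ∧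
    (∀ e : ℝ → E, ContDiffAt ℝ ∞ e 0 → (e =O[𝓝 0] fun s : ℝ => s ^ k) →
      ∃ c : E, (fun s => e s - s ^ k • c) =O[𝓝 0] fun s : ℝ => s ^ (k + 1)) := by
  have integ : ∀ (k : ℕ) (e : ℝ → E) (c : E), ContDiffAt ℝ ∞ e 0 → e 0 = 0 →
      ((fun s => deriv e s - s ^ k • c) =O[𝓝 0] fun s : ℝ => s ^ (k + 1)) →
      (fun s => e s - s ^ (k + 1) • (((k : ℝ) + 1)⁻¹ • c)) =O[𝓝 0]
        fun s : ℝ => s ^ (k + 2) := by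
    intro k e c he h0 h
    refine isBigO_pow_succ_of_deriv ?_ (by simp [h0]) (h.congr' ?_ EventuallyEq.rfl)
    · filter_upwards [he.eventually_differentiableAt] with s hs
      fun_prop
    · filter_upwards [he.eventually_differentiableAt] with s hs
      have h1 : HasDerivAt (fun s : ℝ => s ^ (k + 1) • (((k : ℝ) + 1)⁻¹ • c))
          ((((k + 1 : ℕ) : ℝ) * s ^ k) • (((k : ℝ) + 1)⁻¹ • c)) s := by
        simpa using (hasDerivAt_pow (k + 1) s).smul_const (((k : ℝ) + 1)⁻¹ • c)
      rw [(hs.hasDerivAt.fun_sub h1).deriv, smul_smul]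
      congr 2
      push_cast
      field_simp
  have vanish : ∀ (k : ℕ) (e : ℝ → E), (e =O[𝓝 0] fun s : ℝ => s ^ (k + 1)) → e 0 = 0 := by
    intro k e h
    obtain ⟨C, hC⟩ := h.bound
    have := hC.self_of_nhds
    simpa using this
  induction k with
  | zero =>
    refine ⟨fun e he _ => ?_, fun e he _ => ⟨e 0, ?_⟩⟩
    · simpa using (he.deriv_infty.continuousAt.norm.isBoundedUnder_le).isBigO_one ℝ
    · have := (he.differentiableAt (by simp)).isBigO_sub
      simpa using this
  | succ k ih =>
    obtain ⟨ihT, ihC⟩ := ih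
    have expand : ∀ e : ℝ → E, ContDiffAt ℝ ∞ e 0 → (e =O[𝓝 0] fun s : ℝ => s ^ (k + 1)) →
        ∃ c : E, ((fun s => deriv e s - s ^ k • c) =O[𝓝 0] fun s : ℝ => s ^ (k + 1)) ∧
          (fun s => e s - s ^ (k + 1) • (((k : ℝ) + 1)⁻¹ • c)) =O[𝓝 0]
            fun s : ℝ => s ^ (k + 2) := by
      intro e he h
      obtain ⟨c, hc⟩ := ihC _ he.deriv_infty (ihT e he h)
      exact ⟨c, hc, integ k e c he (vanish k e h) hc⟩
    refine ⟨fun e he h => ?_, fun e he h => ?_⟩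
    · obtain ⟨c, hc, hc'⟩ := expand e he (h.trans (isBigO_pow_of_le (by omega)))
      have h1 : (fun s : ℝ => s ^ (k + 1) • (((k : ℝ) + 1)⁻¹ • c)) =O[𝓝 0]
          fun s : ℝ => s ^ (k + 1 + 1) := by
        simpa using h.sub hc'
      have h2 := eq_zero_of_pow_smul_isBigO h1
      have h3 : c = 0 := by
        rcases smul_eq_zero.1 h2 with h | h
        · exact absurd h (by positivity)
        · exact h
      simpa [h3] using hc
    · obtain ⟨c, -, hc'⟩ := expand e he h
      exact ⟨_, hc'⟩

end Taylor

section FlatGerm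
variable {E : Type} [NormedAddCommGroup E] [NormedSpace ℝ E]

/-- Germs at the origin of maps `G (σ, z)` that vanish to order `M` along `z = 0` and whose
linear part at the origin does not expand the `z` direction. -/
structure FlatGerm (c : ℝ) (M : ℕ) (G : ℝ × E → E) : Prop where
  smooth : ContDiffAt ℝ ∞ G 0
  flat : (fun σ : ℝ => G (σ, 0)) =O[𝓝 0] fun σ : ℝ => σ ^ M
  nonexpanding : ∀ w : E, ‖fderiv ℝ G 0 (0, w)‖ ≤ ‖w‖
  lip : ∀ᶠ p in 𝓝 (0 : ℝ × E), ‖fderiv ℝ G p - fderiv ℝ G 0‖ ≤ c * ‖p‖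

/-- A parabolic contraction `ψ` of a right neighbourhood of `0`, together with a smooth extension
`ρ` of `σ ψ'(σ) / ψ(σ)`. -/
structure ParabolicPair (ψ ρ : ℝ → ℝ) : Prop where
  smooth_left : ContDiffAt ℝ ∞ ψ 0
  smooth_right : ContDiffAt ℝ ∞ ρ 0
  contracts : ∀ᶠ σ in 𝓝[>] (0 : ℝ), 0 < ψ σ ∧ ψ σ ≤ σ - σ ^ 2 / 2
  right_zero : ρ 0 = 1
  deriv_right_zero : |deriv ρ 0| ≤ 1
  mul_eq : ∀ᶠ σ in 𝓝[>] (0 : ℝ), ρ σ * ψ σ = σ * deriv ψ σ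

/-- The iterates, started at `0`, of the operator `f ↦ (σ ↦ G (σ, f (ψ σ)))`. -/
def iter (ψ : ℝ → ℝ) (G : ℝ × E → E) : ℕ → ℝ → E
  | 0, _ => 0
  | n + 1, σ => G (σ, iter ψ G n (ψ σ))

theorem eventually_nhdsGT_exists {p : ℝ → Prop} (h : ∀ᶠ σ in 𝓝[>] (0 : ℝ), p σ) :
    ∃ δ > 0, ∀ σ ∈ Ioo (0 : ℝ) δ, p σ := by
  obtain ⟨δ, hδ, h⟩ := (mem_nhdsGT_iff_exists_Ioo_subset).1 h
  exact ⟨δ, hδ, fun σ hσ => h hσ⟩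

theorem FlatGerm.eventually_lipschitz {c : ℝ} {M : ℕ} {G : ℝ × E → E} (hG : FlatGerm c M G) :
    ∀ᶠ σ in 𝓝[>] (0 : ℝ), ∀ z z' : E, ‖z‖ ≤ σ → ‖z'‖ ≤ σ →
      ‖G (σ, z) - G (σ, z')‖ ≤ (1 + c * σ) * ‖z - z'‖ := by
  obtain ⟨r, hr, hball⟩ := Metric.eventually_nhds_iff_ball.1
    (hG.smooth.eventually_differentiableAt.and hG.lip)
  filter_upwards [Ioo_mem_nhdsGT hr] with σ hσ z z' hz hz'
  have hnorm : ∀ w ∈ Metric.closedBall (0 : E) σ, ‖((σ, w) : ℝ × E)‖ = σ := by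
    intro w hw
    have : ‖w‖ ≤ σ := by simpa using hw
    rw [Prod.norm_mk, Real.norm_eq_abs, abs_of_pos hσ.1, max_eq_left this]
  have hmem : ∀ w ∈ Metric.closedBall (0 : E) σ, ((σ, w) : ℝ × E) ∈ Metric.ball 0 r := by
    intro w hw
    rw [mem_ball_zero_iff, hnorm w hw]
    exact hσ.2
  refine (convex_closedBall (0 : E) σ).norm_image_sub_le_of_norm_hasFDerivWithin_le
    (f := fun w => G (σ, w)) (f' := fun w => (fderiv ℝ G (σ, w)).comp (.inr ℝ ℝ E))
    (x := z') (y := z) (fun w hw => ?_) (fun w hw => ?_) (by simpa using hz') (by simpa using hz)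
  · have h1 : HasFDerivAt (fun w : E => ((σ, w) : ℝ × E)) (.inr ℝ ℝ E) w :=
      hasFDerivAt_prodMk_right σ w
    exact ((hball _ (hmem w hw)).1.hasFDerivAt.comp w h1).hasFDerivWithinAt
  · have hb := (hball _ (hmem w hw)).2
    rw [hnorm w hw] at hb
    have hc : 0 ≤ 1 + c * σ := by
      have := (norm_nonneg _).trans hb
      linarith
    refine ContinuousLinearMap.opNorm_le_bound _ hc fun v => ?_
    have hv : ‖((0, v) : ℝ × E)‖ = ‖v‖ := by simp [Prod.norm_mk]
    have h1 := (fderiv ℝ G (σ, w) - fderiv ℝ G 0).le_of_opNorm_le hb (0, v)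
    rw [hv] at h1
    calc ‖((fderiv ℝ G (σ, w)).comp (.inr ℝ ℝ E)) v‖
        = ‖(fderiv ℝ G (σ, w) - fderiv ℝ G 0) (0, v) + fderiv ℝ G 0 (0, v)‖ := by simp
      _ ≤ c * σ * ‖v‖ + ‖v‖ := (norm_add_le _ _).trans (add_le_add h1 (hG.nonexpanding v))
      _ = (1 + c * σ) * ‖v‖ := by ring

/-- The weight `σ ^ m` absorbs the expansion rate `1 + c σ` along `ψ`. -/
theorem one_add_mul_mul_pow_le {c σ t : ℝ} {m : ℕ} (hm : 2 * c ≤ m) (hσ0 : 0 < σ)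
    (ht0 : 0 < t) (ht : t ≤ σ - σ ^ 2 / 2) : (1 + c * σ) * t ^ m ≤ σ ^ m := by
  have h1 : 1 + c * σ ≤ (1 + σ / 2) ^ m := by
    have := one_add_mul_le_pow (a := σ / 2) (by linarith) m
    nlinarith
  have h2 : (1 + σ / 2) * t ≤ σ := by nlinarith
  calc (1 + c * σ) * t ^ m ≤ (1 + σ / 2) ^ m * t ^ m := by gcongr
    _ = ((1 + σ / 2) * t) ^ m := (mul_pow _ _ _).symm
    _ ≤ σ ^ m := by gcongr

theorem div_one_add_le {σ t : ℝ} (n : ℕ) (hσ0 : 0 < σ)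
    (ht0 : 0 < t) (ht : t ≤ σ - σ ^ 2 / 2) :
    t / (1 + n * t / 2) ≤ σ / (1 + (n + 1 : ℕ) * σ / 2) := by
  rw [div_le_div_iff₀ (by positivity) (by positivity)]
  push_cast
  nlinarith

theorem FlatGerm.exists_limit [CompleteSpace E] {c : ℝ} {M m : ℕ} {G : ℝ × E → E} {ψ ρ : ℝ → ℝ}
    (hψ : ParabolicPair ψ ρ) (hG : FlatGerm c M G) (hc : 0 ≤ c) (hm : 2 * c ≤ m)
    (hM : m + 3 ≤ M) :
    ∃ δ > 0, ∃ f : ℝ → E, ∀ n : ℕ, ∀ σ ∈ Ioo (0 : ℝ) δ,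
      ‖f σ - iter ψ G n σ‖ ≤ σ ^ m * (2 / (n + 1)) := by
  obtain ⟨C, hC⟩ := (hG.flat.trans (isBigO_pow_of_le hM)).bound
  have hsmall : ∀ᶠ σ in 𝓝[>] (0 : ℝ), σ < 1 ∧ C * σ ≤ 1 / 2 := by
    have h1 : ∀ᶠ σ in 𝓝[>] (0 : ℝ), σ < 1 :=
      (eventually_lt_nhds one_pos).filter_mono nhdsWithin_le_nhds
    have h2 : Tendsto (fun s : ℝ => C * s) (𝓝[>] 0) (𝓝 0) := by
      have : Tendsto (fun s : ℝ => C * s) (𝓝 0) (𝓝 (C * 0)) := (continuous_const_mul C).tendsto 0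
      rw [mul_zero] at this
      exact this.mono_left nhdsWithin_le_nhds
    filter_upwards [h1, h2.eventually (eventually_le_nhds (by norm_num : (0 : ℝ) < 1 / 2))]
      with σ h h' using ⟨h, h'⟩
  obtain ⟨δ, hδ, H⟩ := eventually_nhdsGT_exists
    ((hψ.contracts.and hG.eventually_lipschitz).and
      (hsmall.and (hC.filter_mono nhdsWithin_le_nhds)))
  have hψmem : ∀ σ ∈ Ioo (0 : ℝ) δ, ψ σ ∈ Ioo (0 : ℝ) δ := fun σ hσ =>
    ⟨(H σ hσ).1.1.1, by nlinarith [(H σ hσ).1.1.2, hσ.2, sq_nonneg σ]⟩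
  have hpow : ∀ σ ∈ Ioo (0 : ℝ) δ, ψ σ ^ (m + 1) ≤ σ := fun σ hσ => by
    have h1 := hψmem σ hσ
    have h2 : ψ σ ^ (m + 1) ≤ ψ σ :=
      pow_le_of_le_one h1.1.le (H _ h1).2.1.1.le (by omega)
    nlinarith [(H σ hσ).1.1.2, sq_nonneg σ]
  have bound : ∀ n : ℕ, ∀ σ ∈ Ioo (0 : ℝ) δ, ‖iter ψ G n σ‖ ≤ σ ^ (m + 1) := by
    intro n
    induction n with
    | zero => intro σ hσ; simpa [iter] using pow_nonneg hσ.1.le (m + 1)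
    | succ n ih =>
      intro σ hσ
      obtain ⟨⟨⟨hψ0, hψ1⟩, hL⟩, ⟨hσ1, hCσ⟩, hfl⟩ := H σ hσ
      have hi := ih _ (hψmem σ hσ)
      have h1 := hL (iter ψ G n (ψ σ)) 0 (hi.trans (hpow σ hσ)) (by simpa using hσ.1.le)
      have h2 := one_add_mul_mul_pow_le hm hσ.1 hψ0 hψ1
      rw [norm_pow, Real.norm_eq_abs, abs_of_pos hσ.1] at hfl
      have hσ0 := hσ.1
      have hc' : 0 ≤ 1 + c * σ := by positivity
      have h3 : C * σ ^ (m + 3) ≤ σ ^ m * (σ ^ 2 / 2) := by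
        have : C * σ ^ (m + 3) = σ ^ m * (σ ^ 2 * (C * σ)) := by ring
        rw [this]
        gcongr
        nlinarith [sq_nonneg σ]
      calc ‖G (σ, iter ψ G n (ψ σ))‖
          = ‖(G (σ, iter ψ G n (ψ σ)) - G (σ, 0)) + G (σ, 0)‖ := by simp
        _ ≤ (1 + c * σ) * ‖iter ψ G n (ψ σ) - 0‖ + C * σ ^ (m + 3) :=
          (norm_add_le _ _).trans (add_le_add h1 hfl)
        _ ≤ (1 + c * σ) * ψ σ ^ (m + 1) + C * σ ^ (m + 3) := by
          rw [sub_zero]; gcongr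
        _ = ((1 + c * σ) * ψ σ ^ m) * ψ σ + C * σ ^ (m + 3) := by ring
        _ ≤ σ ^ m * (σ - σ ^ 2 / 2) + σ ^ m * (σ ^ 2 / 2) := by gcongr
        _ = σ ^ (m + 1) := by ring
  have cauchy : ∀ n j : ℕ, ∀ σ ∈ Ioo (0 : ℝ) δ,
      ‖iter ψ G (n + j) σ - iter ψ G n σ‖ ≤ σ ^ m * (σ / (1 + n * σ / 2)) := by
    intro n
    induction n with
    | zero => intro j σ hσ; simpa [iter, pow_succ] using bound j σ hσ
    | succ n ih =>
      intro j σ hσ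
      obtain ⟨⟨⟨hψ0, hψ1⟩, hL⟩, ⟨hσ1, hCσ⟩, hfl⟩ := H σ hσ
      have hσ0 := hσ.1
      have hc' : 0 ≤ 1 + c * σ := by positivity
      have h2 := one_add_mul_mul_pow_le hm hσ.1 hψ0 hψ1
      have hb : ∀ k, ‖iter ψ G k (ψ σ)‖ ≤ σ := fun k =>
        (bound k _ (hψmem σ hσ)).trans (hpow σ hσ)
      rw [show n + 1 + j = (n + j) + 1 by omega]
      calc ‖G (σ, iter ψ G (n + j) (ψ σ)) - G (σ, iter ψ G n (ψ σ))‖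
          ≤ (1 + c * σ) * ‖iter ψ G (n + j) (ψ σ) - iter ψ G n (ψ σ)‖ := hL _ _ (hb _) (hb _)
        _ ≤ (1 + c * σ) * (ψ σ ^ m * (ψ σ / (1 + n * ψ σ / 2))) := by
          gcongr; exact ih j _ (hψmem σ hσ)
        _ = ((1 + c * σ) * ψ σ ^ m) * (ψ σ / (1 + n * ψ σ / 2)) := by ring
        _ ≤ σ ^ m * (σ / (1 + (n + 1 : ℕ) * σ / 2)) := by
          gcongr ?_ * ?_
          exact div_one_add_le n hσ.1 hψ0 hψ1
  have rate : ∀ n j : ℕ, ∀ σ ∈ Ioo (0 : ℝ) δ,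
      ‖iter ψ G (n + j) σ - iter ψ G n σ‖ ≤ σ ^ m * (2 / (n + 1)) := by
    intro n j σ hσ
    have hσ0 := hσ.1
    refine (cauchy n j σ hσ).trans ?_
    gcongr ?_ * ?_
    rw [div_le_div_iff₀ (by positivity) (by positivity)]
    nlinarith [(H σ hσ).2.1.1]
  have lim : ∀ σ ∈ Ioo (0 : ℝ) δ, ∃ l, Tendsto (fun n => iter ψ G n σ) atTop (𝓝 l) := by
    intro σ hσ
    refine cauchySeq_tendsto_of_complete
      (cauchySeq_of_le_tendsto_0 (fun n : ℕ => 2 * (σ ^ m * (2 / ((n : ℝ) + 1)))) ?_ ?_)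
    · intro a b N ha hb
      obtain ⟨i, rfl⟩ := Nat.exists_eq_add_of_le ha
      obtain ⟨j, rfl⟩ := Nat.exists_eq_add_of_le hb
      have h1 := rate N i σ hσ
      have h2 := rate N j σ hσ
      rw [← dist_eq_norm] at h1 h2
      linarith [dist_triangle_right (iter ψ G (N + i) σ) (iter ψ G (N + j) σ) (iter ψ G N σ)]
    · have : Tendsto (fun n : ℕ => 4 * σ ^ m * (1 / ((n : ℝ) + 1))) atTop (𝓝 (4 * σ ^ m * 0)) :=
        tendsto_one_div_add_atTop_nhds_zero_nat.const_mul _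
      rw [mul_zero] at this
      refine this.congr fun n => ?_
      ring
  choose! f hf using lim
  refine ⟨δ, hδ, f, fun n σ hσ => ?_⟩
  refine le_of_tendsto (((hf σ hσ).sub_const (iter ψ G n σ)).norm) ?_
  filter_upwards [eventually_ge_atTop n] with k hk
  obtain ⟨j, rfl⟩ := Nat.exists_eq_add_of_le hk
  exact rate n j σ hσ

end FlatGerm

section Prolong
variable {E : Type} [NormedAddCommGroup E] [NormedSpace ℝ E]

/-- The prolongation of `G`: if `f` satisfies `f σ = G (σ, f (ψ σ))`, then `(f, σ f')` satisfies
the same equation with `G` replaced by its prolongation. -/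
noncomputable def prolong (ρ : ℝ → ℝ) (G : ℝ × E → E) (p : ℝ × E × E) : E × E :=
  (G (p.1, p.2.1), fderiv ℝ G (p.1, p.2.1) (p.1, ρ p.1 • p.2.2))

theorem hasFDerivAt_prolong {ρ : ℝ → ℝ} {G : ℝ × E → E} {p : ℝ × E × E}
    (hG : DifferentiableAt ℝ G (p.1, p.2.1))
    (hG' : DifferentiableAt ℝ (fderiv ℝ G) (p.1, p.2.1)) (hρ : DifferentiableAt ℝ ρ p.1)
    (h : ℝ × E × E) :
    DifferentiableAt ℝ (prolong ρ G) p ∧ fderiv ℝ (prolong ρ G) p h =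
      (fderiv ℝ G (p.1, p.2.1) (h.1, h.2.1),
        fderiv ℝ G (p.1, p.2.1) (h.1, ρ p.1 • h.2.2 + (deriv ρ p.1 * h.1) • p.2.2) +
          fderiv ℝ (fderiv ℝ G) (p.1, p.2.1) (h.1, h.2.1) (p.1, ρ p.1 • p.2.2)) := by
  have hσ : HasFDerivAt (fun q : ℝ × E × E => q.1) (.fst ℝ ℝ (E × E)) p := hasFDerivAt_fst
  have hz : HasFDerivAt (fun q : ℝ × E × E => q.2.1)
      ((ContinuousLinearMap.fst ℝ E E).comp (.snd ℝ ℝ (E × E))) p :=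
    hasFDerivAt_fst.comp p hasFDerivAt_snd
  have hw : HasFDerivAt (fun q : ℝ × E × E => q.2.2)
      ((ContinuousLinearMap.snd ℝ E E).comp (.snd ℝ ℝ (E × E))) p :=
    hasFDerivAt_snd.comp p hasFDerivAt_snd
  have hπ := hσ.prodMk hz
  have hρ' : HasFDerivAt (fun q : ℝ × E × E => ρ q.1)
      (deriv ρ p.1 • ContinuousLinearMap.fst ℝ ℝ (E × E)) p :=
    hρ.hasDerivAt.comp_hasFDerivAt p hσ
  have hv := hσ.prodMk (hρ'.fun_smul hw)
  have h1 := (hG.hasFDerivAt (x := (p.1, p.2.1))).comp p hπ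
  have h2 := ((hG'.hasFDerivAt (x := (p.1, p.2.1))).comp p hπ).clm_apply hv
  have h3 := h1.prodMk h2
  refine ⟨h3.differentiableAt, ?_⟩
  have h4 : HasFDerivAt (prolong ρ G) _ p := h3
  rw [h4.fderiv]
  simp

theorem eventually_norm_sub_le_of_deriv {F : Type*} [NormedAddCommGroup F] [NormedSpace ℝ F]
    {f : ℝ → F} {K : ℝ} (hf : ContDiffAt ℝ ∞ f 0) (hK : ‖deriv f 0‖ < K) :
    ∀ᶠ σ in 𝓝 (0 : ℝ), ‖deriv f σ‖ ≤ K ∧ ‖f σ - f 0‖ ≤ K * |σ| := by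
  obtain ⟨r, hr, hball⟩ := Metric.eventually_nhds_iff_ball.1
    (hf.eventually_differentiableAt.and
      (hf.deriv_infty.continuousAt.norm.eventually (eventually_lt_nhds hK)))
  filter_upwards [Metric.ball_mem_nhds (0 : ℝ) hr] with σ hσ
  refine ⟨(hball σ hσ).2.le, ?_⟩
  simpa using (convex_ball (0 : ℝ) r).norm_image_sub_le_of_norm_deriv_le
    (fun t ht => (hball t ht).1) (fun t ht => (hball t ht).2.le) (Metric.mem_ball_self hr) hσ

theorem FlatGerm.prolong_smooth {c : ℝ} {M : ℕ} {G : ℝ × E → E} {ρ : ℝ → ℝ}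
    (hG : FlatGerm c M G) (hρ : ContDiffAt ℝ ∞ ρ 0) : ContDiffAt ℝ ∞ (prolong ρ G) 0 := by
  have hσ : ContDiffAt ℝ ∞ (fun q : ℝ × E × E => q.1) 0 := contDiffAt_fst
  have hπ : ContDiffAt ℝ ∞ (fun q : ℝ × E × E => (q.1, q.2.1)) 0 := by fun_prop
  have hρ' : ContDiffAt ℝ ∞ (fun q : ℝ × E × E => ρ q.1) 0 :=
    ContDiffAt.comp (0 : ℝ × E × E) (g := ρ) hρ hσ
  have hv : ContDiffAt ℝ ∞ (fun q : ℝ × E × E => (q.1, ρ q.1 • q.2.2)) 0 := by fun_prop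
  have h1 : ContDiffAt ℝ ∞ (fun q : ℝ × E × E => G (q.1, q.2.1)) 0 :=
    ContDiffAt.comp (0 : ℝ × E × E) (g := G) hG.smooth hπ
  have h2 : ContDiffAt ℝ ∞ (fun q : ℝ × E × E => fderiv ℝ G (q.1, q.2.1)) 0 :=
    ContDiffAt.comp (0 : ℝ × E × E) (g := fderiv ℝ G)
      (hG.smooth.fderiv_right (m := ∞) (by simp)) hπ
  exact h1.prodMk (h2.clm_apply hv)

theorem FlatGerm.prolong {c : ℝ} {M : ℕ} {G : ℝ × E → E} {ψ ρ : ℝ → ℝ}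
    (hψ : ParabolicPair ψ ρ) (hG : FlatGerm c M G) (hc : 0 ≤ c) (hM : 0 < M) :
    FlatGerm (5 * c + 6) M (prolong ρ G) where
  smooth := hG.prolong_smooth hψ.smooth_right
  flat := by
    obtain ⟨k, rfl⟩ : ∃ k, M = k + 1 := ⟨M - 1, by omega⟩
    have hline : ContDiffAt ℝ ∞ (fun σ : ℝ => ((σ, 0) : ℝ × E)) 0 := by fun_prop
    have he : ContDiffAt ℝ ∞ (fun σ : ℝ => G (σ, 0)) 0 :=
      ContDiffAt.comp (0 : ℝ) (g := G) hG.smooth hline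
    have hd := (taylor_of_isBigO k).1 _ he hG.flat
    have hd' := (isBigO_refl (fun s : ℝ => s) (𝓝 0)).smul hd
    refine IsBigO.prod_left hG.flat (hd'.congr' ?_ ?_)
    · filter_upwards [hline.continuousAt.eventually hG.smooth.eventually_differentiableAt]
        with σ hσ
      have h1 : HasDerivAt (fun σ : ℝ => ((σ, 0) : ℝ × E)) (1, 0) σ :=
        (hasDerivAt_id σ).prodMk (hasDerivAt_const σ 0)
      have h2 := hσ.hasFDerivAt.comp_hasDerivAt σ h1
      have h3 : deriv (fun σ : ℝ => G (σ, 0)) σ = fderiv ℝ G (σ, 0) (1, 0) := h2.deriv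
      rw [h3, ← map_smul]
      simp
    · exact Eventually.of_forall fun s => by simp [pow_succ, mul_comm]
  nonexpanding w := by
    have hG' := (hG.smooth.fderiv_right (m := ∞) (by simp)).differentiableAt (by simp)
    rw [(hasFDerivAt_prolong (p := 0) (hG.smooth.differentiableAt (by simp)) hG'
      (hψ.smooth_right.differentiableAt (by simp)) (0, w)).2]
    have h0 : (((0 : ℝ × E × E).1, (0 : ℝ × E × E).2.1) : ℝ × E) = 0 := rfl
    simp only [Prod.fst_zero, Prod.snd_zero, smul_zero, mul_zero, add_zero, hψ.right_zero,
      one_smul]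
    have h00 : ((0, 0) : ℝ × E) = 0 := rfl
    rw [h00, map_zero, add_zero, Prod.norm_mk]
    exact max_le ((hG.nonexpanding _).trans (norm_fst_le w))
      ((hG.nonexpanding _).trans (norm_snd_le w))
  lip := by
    have hG' : ContDiffAt ℝ ∞ (fderiv ℝ G) 0 := hG.smooth.fderiv_right (by simp)
    have hπ : Tendsto (fun q : ℝ × E × E => (q.1, q.2.1)) (𝓝 0) (𝓝 0) := by
      have : Continuous (fun q : ℝ × E × E => (q.1, q.2.1)) := by fun_prop
      exact this.tendsto 0
    have hσ : Tendsto (fun q : ℝ × E × E => q.1) (𝓝 0) (𝓝 0) := continuous_fst.tendsto 0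
    have hD2 : ‖fderiv ℝ (fderiv ℝ G) 0‖ ≤ c := by
      refine (hG'.differentiableAt (by simp)).hasFDerivAt.le_of_lip' hc ?_
      simpa using hG.lip
    have hD2' : ∀ᶠ p in 𝓝 (0 : ℝ × E), ‖fderiv ℝ (fderiv ℝ G) p‖ ≤ c + 1 := by
      have h := (hG'.fderiv_right (m := ∞) (by simp)).continuousAt.norm
      filter_upwards [h.eventually (eventually_lt_nhds (hD2.trans_lt (lt_add_one c)))]
        with p hp using hp.le
    have hρ := eventually_norm_sub_le_of_deriv (K := 2) hψ.smooth_right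
      (by rw [Real.norm_eq_abs]; linarith [hψ.deriv_right_zero])
    filter_upwards [hπ.eventually (((hG.smooth.eventually_differentiableAt).and
      hG'.eventually_differentiableAt).and (hG.lip.and hD2')),
      hσ.eventually (hψ.smooth_right.eventually_differentiableAt.and hρ),
      Metric.ball_mem_nhds (0 : ℝ × E × E) (by norm_num : (0 : ℝ) < 1 / 2)]
      with p ⟨⟨hd1, hd2⟩, hlip, hp2⟩ ⟨hρd, hρ1, hρ2⟩ hpb
    have hpb' : ‖p‖ ≤ 1 / 2 := by simpa using (mem_ball_zero_iff.1 hpb).le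
    have hp0 : ‖p.1‖ ≤ ‖p‖ := norm_fst_le p
    have hp21 : ‖p.2.1‖ ≤ ‖p‖ := (norm_fst_le p.2).trans (norm_snd_le p)
    have hp22 : ‖p.2.2‖ ≤ ‖p‖ := (norm_snd_le p.2).trans (norm_snd_le p)
    have hπp : ‖((p.1, p.2.1) : ℝ × E)‖ ≤ ‖p‖ := max_le hp0 hp21
    rw [hψ.right_zero] at hρ2
    have hρsub : ‖ρ p.1 - 1‖ ≤ 2 * ‖p‖ := hρ2.trans (by gcongr; exact hp0)
    have hρabs : ‖ρ p.1‖ ≤ 2 := by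
      have := norm_add_le (ρ p.1 - 1) 1
      simp only [sub_add_cancel, norm_one] at this
      linarith
    refine ContinuousLinearMap.opNorm_le_bound _ (by positivity) fun h => ?_
    have hh0 : ‖h.1‖ ≤ ‖h‖ := norm_fst_le h
    have hh21 : ‖h.2.1‖ ≤ ‖h‖ := (norm_fst_le h.2).trans (norm_snd_le h)
    have hh22 : ‖h.2.2‖ ≤ ‖h‖ := (norm_snd_le h.2).trans (norm_snd_le h)
    have hπh : ‖((h.1, h.2.1) : ℝ × E)‖ ≤ ‖h‖ := max_le hh0 hh21
    rw [_root_.sub_apply, (hasFDerivAt_prolong hd1 hd2 hρd h).2,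
      (hasFDerivAt_prolong (p := 0) (hG.smooth.differentiableAt (by simp))
        (hG'.differentiableAt (by simp)) (hψ.smooth_right.differentiableAt (by simp)) h).2]
    have h0 : (((0 : ℝ × E × E).1, (0 : ℝ × E × E).2.1) : ℝ × E) = 0 := rfl
    have h00 : ((0, 0) : ℝ × E) = 0 := rfl
    simp only [Prod.fst_zero, Prod.snd_zero, smul_zero, add_zero, hψ.right_zero, one_smul,
      h00, map_zero]
    set A := fderiv ℝ G (p.1, p.2.1)
    set A0 := fderiv ℝ G 0
    set B := fderiv ℝ (fderiv ℝ G) (p.1, p.2.1)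
    have hA : ∀ v, ‖(A - A0) v‖ ≤ c * ‖p‖ * ‖v‖ := fun v =>
      (A - A0).le_of_opNorm_le (hlip.trans (by gcongr)) v
    have hcorr : ‖(deriv ρ p.1 * h.1) • p.2.2‖ ≤ 2 * ‖h‖ * ‖p‖ := by
      rw [norm_smul, norm_mul]
      gcongr
    have hv' : ‖((h.1, ρ p.1 • h.2.2 + (deriv ρ p.1 * h.1) • p.2.2) : ℝ × E)‖ ≤ 3 * ‖h‖ := by
      refine max_le (by linarith [norm_nonneg h]) ((norm_add_le _ _).trans ?_)
      have h1 : ‖ρ p.1 • h.2.2‖ ≤ 2 * ‖h‖ := by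
        rw [norm_smul]; gcongr
      have h2 : 2 * ‖h‖ * ‖p‖ ≤ ‖h‖ := by nlinarith [norm_nonneg h]
      linarith
    have hv : ‖((p.1, ρ p.1 • p.2.2) : ℝ × E)‖ ≤ 2 * ‖p‖ := by
      refine max_le (by linarith [norm_nonneg p]) ?_
      rw [norm_smul]; gcongr
    have hB : ‖B (h.1, h.2.1) (p.1, ρ p.1 • p.2.2)‖ ≤ (c + 1) * ‖h‖ * (2 * ‖p‖) := by
      refine ((B (h.1, h.2.1)).le_opNorm _).trans ?_
      gcongr
      exact (B.le_opNorm _).trans (by gcongr)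
    refine max_le ?_ ?_
    · change ‖(A - A0) (h.1, h.2.1)‖ ≤ _
      refine (hA _).trans ?_
      have : c * ‖p‖ * ‖((h.1, h.2.1) : ℝ × E)‖ ≤ c * ‖p‖ * ‖h‖ := by gcongr
      nlinarith [mul_nonneg hc (mul_nonneg (norm_nonneg p) (norm_nonneg h)),
        mul_nonneg (norm_nonneg p) (norm_nonneg h)]
    · have hsplit : A (h.1, ρ p.1 • h.2.2 + (deriv ρ p.1 * h.1) • p.2.2) +
          B (h.1, h.2.1) (p.1, ρ p.1 • p.2.2) - A0 (h.1, h.2.2) =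
          (A - A0) (h.1, ρ p.1 • h.2.2 + (deriv ρ p.1 * h.1) • p.2.2) +
          A0 (0, (ρ p.1 - 1) • h.2.2 + (deriv ρ p.1 * h.1) • p.2.2) +
          B (h.1, h.2.1) (p.1, ρ p.1 • p.2.2) := by
        have : ((h.1, ρ p.1 • h.2.2 + (deriv ρ p.1 * h.1) • p.2.2) : ℝ × E) =
            (h.1, h.2.2) + (0, (ρ p.1 - 1) • h.2.2 + (deriv ρ p.1 * h.1) • p.2.2) := by
          ext
          · simp
          · simp only [Prod.mk_add_mk]; module
        rw [_root_.sub_apply]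
        conv_rhs => rw [this, map_add A0]
        rw [← this]
        abel
      change ‖A (h.1, ρ p.1 • h.2.2 + (deriv ρ p.1 * h.1) • p.2.2) +
          B (h.1, h.2.1) (p.1, ρ p.1 • p.2.2) - A0 (h.1, h.2.2)‖ ≤ _
      rw [hsplit]
      have t1 := hA (h.1, ρ p.1 • h.2.2 + (deriv ρ p.1 * h.1) • p.2.2)
      have t1' : c * ‖p‖ * ‖((h.1, ρ p.1 • h.2.2 + (deriv ρ p.1 * h.1) • p.2.2) : ℝ × E)‖ ≤
          c * ‖p‖ * (3 * ‖h‖) := by gcongr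
      have t2 : ‖A0 (0, (ρ p.1 - 1) • h.2.2 + (deriv ρ p.1 * h.1) • p.2.2)‖ ≤
          2 * ‖p‖ * ‖h‖ + 2 * ‖h‖ * ‖p‖ := by
        refine (hG.nonexpanding _).trans ((norm_add_le _ _).trans (add_le_add ?_ hcorr))
        rw [norm_smul]; gcongr
      refine (norm_add₃_le).trans ?_
      nlinarith

end Prolong

section FlatDiff
variable {E : Type} [NormedAddCommGroup E] [NormedSpace ℝ E]

/-- `f` is `k` times differentiable on `(0, δ)` along the vector field `σ d/dσ`, and all these
derivatives are `O(σ ^ m)` there. -/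
def FlatDiff (δ : ℝ) : ℕ → ℕ → (ℝ → E) → Prop
  | 0, m, f => ∃ C : ℝ, ∀ σ ∈ Ioo (0 : ℝ) δ, ‖f σ‖ ≤ C * σ ^ m
  | k + 1, m, f => (∃ C : ℝ, ∀ σ ∈ Ioo (0 : ℝ) δ, ‖f σ‖ ≤ C * σ ^ m) ∧
      ∃ w : ℝ → E, FlatDiff δ k m w ∧ ∀ σ ∈ Ioo (0 : ℝ) δ, HasDerivAt f (σ⁻¹ • w σ) σ

namespace FlatDiff

theorem bound {δ : ℝ} {k m : ℕ} {f : ℝ → E} (h : FlatDiff δ k m f) :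
    ∃ C : ℝ, ∀ σ ∈ Ioo (0 : ℝ) δ, ‖f σ‖ ≤ C * σ ^ m := by
  cases k with
  | zero => exact h
  | succ k => exact h.1

theorem mono {δ δ' : ℝ} (hδ : δ' ≤ δ) {k m : ℕ} {f : ℝ → E} (h : FlatDiff δ k m f) :
    FlatDiff δ' k m f := by
  induction k generalizing f with
  | zero =>
    obtain ⟨C, hC⟩ := h
    exact ⟨C, fun σ hσ => hC σ (Ioo_subset_Ioo_right hδ hσ)⟩
  | succ k ih =>
    obtain ⟨⟨C, hC⟩, w, hw, hd⟩ := h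
    exact ⟨⟨C, fun σ hσ => hC σ (Ioo_subset_Ioo_right hδ hσ)⟩, w, ih hw,
      fun σ hσ => hd σ (Ioo_subset_Ioo_right hδ hσ)⟩

theorem of_succ {δ : ℝ} {k m : ℕ} {f : ℝ → E} (h : FlatDiff δ (k + 1) m f) :
    FlatDiff δ k m f := by
  induction k generalizing f with
  | zero => exact h.1
  | succ k ih =>
    obtain ⟨hb, w, hw, hd⟩ := h
    exact ⟨hb, w, ih hw, hd⟩

theorem sub {δ : ℝ} {k m : ℕ} {f g : ℝ → E} (hf : FlatDiff δ k m f) (hg : FlatDiff δ k m g) :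
    FlatDiff δ k m (fun σ => f σ - g σ) := by
  have hb : ∃ C : ℝ, ∀ σ ∈ Ioo (0 : ℝ) δ, ‖f σ - g σ‖ ≤ C * σ ^ m := by
    obtain ⟨C, hC⟩ := hf.bound
    obtain ⟨C', hC'⟩ := hg.bound
    refine ⟨C + C', fun σ hσ => (norm_sub_le _ _).trans ?_⟩
    rw [add_mul]
    exact add_le_add (hC σ hσ) (hC' σ hσ)
  induction k generalizing f g with
  | zero => exact hb
  | succ k ih =>
    obtain ⟨-, w, hw, hd⟩ := hf
    obtain ⟨-, w', hw', hd'⟩ := hg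
    refine ⟨hb, fun σ => w σ - w' σ, ih hw hw' ?_, fun σ hσ => ?_⟩
    · obtain ⟨C, hC⟩ := hw.bound
      obtain ⟨C', hC'⟩ := hw'.bound
      refine ⟨C + C', fun σ hσ => (norm_sub_le _ _).trans ?_⟩
      rw [add_mul]
      exact add_le_add (hC σ hσ) (hC' σ hσ)
    · rw [smul_sub]
      exact (hd σ hσ).sub (hd' σ hσ)

theorem clm_comp {F : Type} [NormedAddCommGroup F] [NormedSpace ℝ F] (L : E →L[ℝ] F)
    {δ : ℝ} {k m : ℕ} {f : ℝ → E} (hf : FlatDiff δ k m f) :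
    FlatDiff δ k m (fun σ => L (f σ)) := by
  have hb : ∀ {g : ℝ → E}, (∃ C : ℝ, ∀ σ ∈ Ioo (0 : ℝ) δ, ‖g σ‖ ≤ C * σ ^ m) →
      ∃ C : ℝ, ∀ σ ∈ Ioo (0 : ℝ) δ, ‖L (g σ)‖ ≤ C * σ ^ m := by
    rintro g ⟨C, hC⟩
    refine ⟨‖L‖ * C, fun σ hσ => (L.le_opNorm _).trans ?_⟩
    rw [mul_assoc]
    exact mul_le_mul_of_nonneg_left (hC σ hσ) (norm_nonneg _)
  induction k generalizing f with
  | zero => exact hb hf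
  | succ k ih =>
    obtain ⟨hf, w, hw, hd⟩ := hf
    refine ⟨hb hf, fun σ => L (w σ), ih hw, fun σ hσ => ?_⟩
    rw [← map_smul]
    exact L.hasFDerivAt.comp_hasDerivAt σ (hd σ hσ)

theorem inv_smul {δ : ℝ} {k m : ℕ} {f : ℝ → E} (hf : FlatDiff δ k (m + 1) f) :
    FlatDiff δ k m (fun σ => σ⁻¹ • f σ) := by
  have hb : ∀ {g : ℝ → E}, (∃ C : ℝ, ∀ σ ∈ Ioo (0 : ℝ) δ, ‖g σ‖ ≤ C * σ ^ (m + 1)) →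
      ∃ C : ℝ, ∀ σ ∈ Ioo (0 : ℝ) δ, ‖σ⁻¹ • g σ‖ ≤ C * σ ^ m := by
    rintro g ⟨C, hC⟩
    refine ⟨C, fun σ hσ => ?_⟩
    have hσ0 := hσ.1
    rw [norm_smul, norm_inv, Real.norm_eq_abs, abs_of_pos hσ.1, inv_mul_le_iff₀ hσ.1]
    refine (hC σ hσ).trans (le_of_eq ?_)
    ring
  induction k generalizing f with
  | zero => exact hb hf
  | succ k ih =>
    have hf' := hf.of_succ
    obtain ⟨hf, w, hw, hd⟩ := hf
    refine ⟨hb hf, fun σ => σ⁻¹ • (w σ - f σ), ih (hw.sub hf'), fun σ hσ => ?_⟩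
    have hσ0 : σ ≠ 0 := hσ.1.ne'
    have h1 := (hasDerivAt_inv hσ0).fun_smul (hd σ hσ)
    convert h1 using 1
    change σ⁻¹ • σ⁻¹ • (w σ - f σ) = _
    rw [← inv_pow]
    module

/-- Extended by zero to the left, a flat function with `k + 1` derivatives is `C ^ k`. -/
theorem contDiffOn {δ : ℝ} {k m : ℕ} {f : ℝ → E} (hf : FlatDiff δ (k + 1) m f)
    (hm : k + 2 ≤ m) :
    ContDiffOn ℝ k (fun σ => if 0 < σ then f σ else 0) (Iio δ) := by
  have hder : ∀ {m : ℕ} {f w : ℝ → E}, 2 ≤ m →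
      (∃ C : ℝ, ∀ σ ∈ Ioo (0 : ℝ) δ, ‖f σ‖ ≤ C * σ ^ m) →
      (∀ σ ∈ Ioo (0 : ℝ) δ, HasDerivAt f (σ⁻¹ • w σ) σ) →
      ∀ σ ∈ Iio δ, HasDerivAt (fun σ => if 0 < σ then f σ else 0)
        (if 0 < σ then σ⁻¹ • w σ else 0) σ := by
    rintro m f w hm ⟨C, hC⟩ hd σ hσ
    rcases lt_trichotomy 0 σ with h0 | rfl | h0
    · rw [if_pos h0]
      refine (hd σ ⟨h0, hσ⟩).congr_of_eventuallyEq ?_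
      filter_upwards [lt_mem_nhds h0] with t ht
      rw [if_pos ht]
    · rw [if_neg (lt_irrefl _)]
      have hO : (fun σ => if 0 < σ then f σ else 0) =O[𝓝 0] fun s : ℝ => s ^ m := by
        refine IsBigO.of_bound |C| ?_
        filter_upwards [gt_mem_nhds hσ] with t ht
        split_ifs with ht0
        · refine (hC t ⟨ht0, ht⟩).trans ?_
          rw [norm_pow, Real.norm_eq_abs, abs_of_pos ht0]
          gcongr
          exact le_abs_self C
        · rw [norm_zero]; positivity
      have h2 := hO.trans (isBigO_pow_of_le hm)
      rw [hasDerivAt_iff_isLittleO]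
      simp only [lt_irrefl, if_false, sub_zero, smul_zero]
      refine h2.trans_isLittleO ?_
      simpa using isLittleO_pow_pow (𝕜 := ℝ) (show 1 < 2 by norm_num)
    · rw [if_neg h0.not_gt]
      refine (hasDerivAt_const σ (0 : E)).congr_of_eventuallyEq ?_
      filter_upwards [gt_mem_nhds h0] with t ht
      rw [if_neg ht.not_gt]
  induction k generalizing f m with
  | zero =>
    obtain ⟨hb, w, -, hd⟩ := hf
    rw [Nat.cast_zero, contDiffOn_zero]
    exact fun σ hσ => (hder (by omega) hb hd σ hσ).continuousAt.continuousWithinAt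
  | succ k ih =>
    obtain ⟨n, rfl⟩ : ∃ n, m = n + 1 := ⟨m - 1, by omega⟩
    obtain ⟨hb, w, hw, hd⟩ := hf
    have h1 := hder (by omega) hb hd
    rw [Nat.cast_succ, contDiffOn_succ_iff_deriv_of_isOpen isOpen_Iio]
    refine ⟨fun σ hσ => (h1 σ hσ).differentiableAt.differentiableWithinAt, by simp, ?_⟩
    exact (ih hw.inv_smul (by omega)).congr fun σ hσ => (h1 σ hσ).deriv

end FlatDiff

/-- The Lipschitz constant of the `k`-fold prolongation. -/
def prolongConst : ℕ → ℝ → ℝ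
  | 0, c => c
  | k + 1, c => prolongConst k (5 * c + 6)

theorem iter_prolong_fst (ψ ρ : ℝ → ℝ) (G : ℝ × E → E) (n : ℕ) (σ : ℝ) :
    (iter ψ (prolong ρ G) n σ).1 = iter ψ G n σ := by
  induction n generalizing σ with
  | zero => rfl
  | succ n ih => simp [iter, prolong, ih]

theorem hasDerivAt_iter {ψ ρ : ℝ → ℝ} {G : ℝ × E → E} {δ : ℝ}
    (hψ : ∀ σ ∈ Ioo (0 : ℝ) δ, ψ σ ∈ Ioo (0 : ℝ) δ ∧ DifferentiableAt ℝ ψ σ ∧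
      ρ σ * ψ σ = σ * deriv ψ σ)
    (hG : ∀ σ ∈ Ioo (0 : ℝ) δ, ∀ n, DifferentiableAt ℝ G (σ, iter ψ G n (ψ σ)))
    (n : ℕ) : ∀ σ ∈ Ioo (0 : ℝ) δ,
      HasDerivAt (iter ψ G n) (σ⁻¹ • (iter ψ (prolong ρ G) n σ).2) σ := by
  induction n with
  | zero =>
    intro σ hσ
    simpa [iter] using hasDerivAt_const σ (0 : E)
  | succ n ih =>
    intro σ hσ
    obtain ⟨hmem, hd, heq⟩ := hψ σ hσ
    have h1 := (ih _ hmem).scomp σ hd.hasDerivAt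
    have h2 := (hG σ hσ n).hasFDerivAt.comp_hasDerivAt σ ((hasDerivAt_id σ).prodMk h1)
    refine h2.congr_deriv ?_
    simp only [iter, prolong, iter_prolong_fst]
    rw [← map_smul]
    congr 1
    have hσ0 : σ ≠ 0 := hσ.1.ne'
    have hψ0 : ψ σ ≠ 0 := hmem.1.ne'
    ext
    · simp [hσ0]
    · simp only [Prod.smul_mk, smul_smul]
      congr 1
      field_simp
      linarith

theorem FlatGerm.exists_flatDiff [CompleteSpace E] {ψ ρ : ℝ → ℝ} (hψ : ParabolicPair ψ ρ)
    {c : ℝ} {k m M : ℕ} {G : ℝ × E → E} (hG : FlatGerm c M G) (hc : 0 ≤ c) (hm1 : 1 ≤ m)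
    (hm : 2 * prolongConst k c ≤ m) (hM : m + 3 ≤ M) :
    ∃ δ > 0, ∃ f : ℝ → E, (∀ n : ℕ, ∀ σ ∈ Ioo (0 : ℝ) δ,
      ‖f σ - iter ψ G n σ‖ ≤ σ ^ m * (2 / (n + 1))) ∧ FlatDiff δ k m f := by
  have base : ∀ {E : Type} [NormedAddCommGroup E] {δ : ℝ} {f : ℝ → E} {g : ℕ → ℝ → E},
      (∀ n : ℕ, ∀ σ ∈ Ioo (0 : ℝ) δ, ‖f σ - g n σ‖ ≤ σ ^ m * (2 / (n + 1))) → g 0 = 0 →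
      ∀ σ ∈ Ioo (0 : ℝ) δ, ‖f σ‖ ≤ 2 * σ ^ m := by
    intro E _ δ f g h h0 σ hσ
    have := h 0 σ hσ
    simp only [h0, Pi.zero_apply, sub_zero, Nat.cast_zero, zero_add, div_one] at this
    linarith
  induction k generalizing E c with
  | zero =>
    obtain ⟨δ, hδ, f, hf⟩ := hG.exists_limit hψ hc hm hM
    exact ⟨δ, hδ, f, hf, 2, base hf rfl⟩
  | succ k ih =>
    obtain ⟨δ₀, hδ₀, D, hD, hDk⟩ := ih (hG.prolong hψ hc (by omega)) (by positivity) hm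
    obtain ⟨r, hr, hball⟩ :=
      Metric.eventually_nhds_iff_ball.1 hG.smooth.eventually_differentiableAt
    obtain ⟨δ₁, hδ₁, H⟩ := eventually_nhdsGT_exists ((hψ.contracts.and hψ.mul_eq).and
      (hψ.smooth_left.eventually_differentiableAt.filter_mono nhdsWithin_le_nhds))
    set δ := min (min δ₀ δ₁) (min (r / 4) 1) with hδ
    have hδ0 : δ ≤ δ₀ := (min_le_left _ _).trans (min_le_left _ _)
    have hδ1 : δ ≤ δ₁ := (min_le_left _ _).trans (min_le_right _ _)
    have hδr : δ ≤ r / 4 := (min_le_right _ _).trans (min_le_left _ _)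
    have hδone : δ ≤ 1 := (min_le_right _ _).trans (min_le_right _ _)
    have hδpos : 0 < δ := by positivity
    have hD' : ∀ n : ℕ, ∀ σ ∈ Ioo (0 : ℝ) δ,
        ‖D σ - iter ψ (_root_.prolong ρ G) n σ‖ ≤ σ ^ m * (2 / (n + 1)) :=
      fun n σ hσ => hD n σ (Ioo_subset_Ioo_right hδ0 hσ)
    have hrate : ∀ n : ℕ, ∀ σ ∈ Ioo (0 : ℝ) δ,
        ‖(D σ).1 - iter ψ G n σ‖ ≤ σ ^ m * (2 / (n + 1)) := fun n σ hσ => by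
      rw [← iter_prolong_fst ψ ρ G n σ]
      exact (norm_fst_le (D σ - iter ψ (_root_.prolong ρ G) n σ)).trans (hD' n σ hσ)
    have hb := base hrate rfl
    have hpow : ∀ σ ∈ Ioo (0 : ℝ) δ, σ ^ m ≤ σ := fun σ hσ =>
      pow_le_of_le_one hσ.1.le (hσ.2.le.trans hδone) (by omega)
    have hiter : ∀ n : ℕ, ∀ σ ∈ Ioo (0 : ℝ) δ, ‖iter ψ G n σ‖ < r := fun n σ hσ => by
      have h1 := hrate n σ hσ
      have h2 : σ ^ m * (2 / ((n : ℝ) + 1)) ≤ σ ^ m * 2 := by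
        have := hσ.1
        gcongr
        exact div_le_self (by norm_num) (by linarith [(Nat.cast_nonneg n : (0 : ℝ) ≤ n)])
      have h3 := norm_sub_norm_le (iter ψ G n σ) ((D σ).1)
      rw [norm_sub_rev] at h3
      linarith [hb σ hσ, hpow σ hσ, hσ.2]
    have hψ' : ∀ σ ∈ Ioo (0 : ℝ) δ, ψ σ ∈ Ioo (0 : ℝ) δ ∧ DifferentiableAt ℝ ψ σ ∧
        ρ σ * ψ σ = σ * deriv ψ σ := fun σ hσ => by
      obtain ⟨⟨⟨h0, h1⟩, h2⟩, h3⟩ := H σ (Ioo_subset_Ioo_right hδ1 hσ)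
      exact ⟨⟨h0, by nlinarith [hσ.2, sq_nonneg σ]⟩, h3, h2⟩
    have hdiff : ∀ σ ∈ Ioo (0 : ℝ) δ, ∀ n, DifferentiableAt ℝ G (σ, iter ψ G n (ψ σ)) :=
      fun σ hσ n => by
        refine hball _ (mem_ball_zero_iff.2 (max_lt ?_ (hiter n _ (hψ' σ hσ).1)))
        rw [Real.norm_eq_abs, abs_of_pos hσ.1]
        linarith [hσ.2]
    refine ⟨δ, hδpos, fun σ => (D σ).1, hrate, ⟨2, hb⟩, fun σ => (D σ).2,
      (hDk.mono hδ0).clm_comp (.snd ℝ E E), ?_⟩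
    have hunif : TendstoUniformlyOn (fun n σ => σ⁻¹ • (iter ψ (_root_.prolong ρ G) n σ).2)
        (fun σ => σ⁻¹ • (D σ).2) atTop (Ioo 0 δ) := by
      rw [Metric.tendstoUniformlyOn_iff]
      intro ε hε
      have hlim : Tendsto (fun n : ℕ => 2 * (1 / ((n : ℝ) + 1))) atTop (𝓝 (2 * 0)) :=
        tendsto_one_div_add_atTop_nhds_zero_nat.const_mul _
      rw [mul_zero] at hlim
      filter_upwards [hlim.eventually (eventually_lt_nhds hε)] with n hn σ hσ
      refine lt_of_le_of_lt ?_ hn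
      have hσ0 := hσ.1
      rw [dist_eq_norm, ← smul_sub, norm_smul, norm_inv, Real.norm_eq_abs, abs_of_pos hσ.1,
        inv_mul_le_iff₀ hσ.1]
      refine (norm_snd_le (D σ - iter ψ (_root_.prolong ρ G) n σ)).trans
        ((hD' n σ hσ).trans ?_)
      rw [mul_one_div]
      gcongr
      exact hpow σ hσ
    refine fun σ hσ => hasDerivAt_of_tendstoUniformlyOn isOpen_Ioo hunif
      (Eventually.of_forall fun n => hasDerivAt_iter hψ' hdiff n) (fun t ht => ?_) hσ
    rw [tendsto_iff_norm_sub_tendsto_zero]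
    have hlim : Tendsto (fun n : ℕ => t ^ m * 2 * (1 / ((n : ℝ) + 1))) atTop
        (𝓝 (t ^ m * 2 * 0)) := tendsto_one_div_add_atTop_nhds_zero_nat.const_mul _
    rw [mul_zero] at hlim
    refine squeeze_zero (fun _ => norm_nonneg _) (fun n => ?_) hlim
    rw [norm_sub_rev, mul_assoc, mul_one_div]
    exact hrate n t ht

end FlatDiff

section Curve

theorem FlatGerm.eventually_fixed {E : Type} [NormedAddCommGroup E] [NormedSpace ℝ E]
    {ψ ρ : ℝ → ℝ} (hψ : ParabolicPair ψ ρ) {c δ : ℝ} {m M : ℕ} {G : ℝ × E → E}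
    (hG : FlatGerm c M G) (hm : 1 ≤ m) (hδ : 0 < δ) {f : ℝ → E}
    (hf : ∀ n : ℕ, ∀ σ ∈ Ioo (0 : ℝ) δ, ‖f σ - iter ψ G n σ‖ ≤ σ ^ m * (2 / (n + 1))) :
    ∀ᶠ σ in 𝓝[>] (0 : ℝ), f σ = G (σ, f (ψ σ)) := by
  obtain ⟨r, hr, hball⟩ :=
    Metric.eventually_nhds_iff_ball.1 hG.smooth.eventually_differentiableAt
  have hlim : ∀ σ ∈ Ioo (0 : ℝ) δ, Tendsto (fun n => iter ψ G n σ) atTop (𝓝 (f σ)) := by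
    intro σ hσ
    rw [tendsto_iff_norm_sub_tendsto_zero]
    have hl : Tendsto (fun n : ℕ => σ ^ m * 2 * (1 / ((n : ℝ) + 1))) atTop
        (𝓝 (σ ^ m * 2 * 0)) := tendsto_one_div_add_atTop_nhds_zero_nat.const_mul _
    rw [mul_zero] at hl
    refine squeeze_zero (fun _ => norm_nonneg _) (fun n => ?_) hl
    rw [norm_sub_rev, mul_assoc, mul_one_div]
    exact hf n σ hσ
  have hη : 0 < min δ (min (r / 2) 1) := by positivity
  filter_upwards [hψ.contracts, Ioo_mem_nhdsGT hη] with σ ⟨h0, h1⟩ hσ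
  have hσ1 : σ < δ := hσ.2.trans_le (min_le_left _ _)
  have hσr : σ < r / 2 := hσ.2.trans_le ((min_le_right _ _).trans (min_le_left _ _))
  have hσ2 : σ < 1 := hσ.2.trans_le ((min_le_right _ _).trans (min_le_right _ _))
  have hψσ : ψ σ ≤ σ := by nlinarith [sq_nonneg σ]
  have hψmem : ψ σ ∈ Ioo (0 : ℝ) δ := ⟨h0, hψσ.trans_lt hσ1⟩
  have hsmall : ‖f (ψ σ)‖ < r := by
    have h2 := hf 0 _ hψmem
    simp only [iter, sub_zero, Nat.cast_zero, zero_add, div_one] at h2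
    have h3 : ψ σ ^ m ≤ ψ σ := pow_le_of_le_one h0.le (hψσ.trans hσ2.le) (by omega)
    linarith
  have hcont : ContinuousAt G (σ, f (ψ σ)) := by
    refine (hball _ (mem_ball_zero_iff.2 (max_lt ?_ hsmall))).continuousAt
    rw [Real.norm_eq_abs, abs_of_pos hσ.1]
    linarith
  have h2 : Tendsto (fun n => iter ψ G (n + 1) σ) atTop (𝓝 (f σ)) :=
    (hlim σ ⟨hσ.1, hσ1⟩).comp (tendsto_add_atTop_nat 1)
  have h3 : Tendsto (fun n => G (σ, iter ψ G n (ψ σ))) atTop (𝓝 (G (σ, f (ψ σ)))) :=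
    hcont.tendsto.comp ((tendsto_const_nhds).prodMk_nhds (hlim _ hψmem))
  exact tendsto_nhds_unique h2 h3

/-- A curve tangent to the first axis is the graph of a function over that axis; invariance of
the curve becomes invariance of the graph. -/
theorem exists_graph_of_curve {Φ : ℝ × ℝ → ℝ × ℝ} {U : Set (ℝ × ℝ)} (hU : U ∈ 𝓝 (0 : ℝ × ℝ))
    (hΦ0 : Φ 0 = 0) {N : ℕ} (hN : 1 ≤ N) {Γ : ℝ → ℝ × ℝ} {ψ : ℝ → ℝ}
    (hΓ : ContDiffAt ℝ N Γ 0) (hΓ0 : Γ 0 = 0) (hd : HasDerivAt (fun s => (Γ s).1) 1 0)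
    {C : ℝ} (hC : 0 ≤ C) (hy : ∀ᶠ s in 𝓝[>] (0 : ℝ), |(Γ s).2| ≤ C * s ^ 3)
    (hinv : ∀ᶠ s in 𝓝[>] (0 : ℝ), 0 < ψ s ∧ ψ s ≤ s ∧ Γ s = Φ (Γ (ψ s))) :
    ∃ δN > (0 : ℝ), ∃ CN > (0 : ℝ), ∃ FN : ℝ → ℝ,
      ContDiffOn ℝ (N : ℕ∞) FN (Icc 0 δN) ∧
      (∀ x ∈ Icc (0 : ℝ) δN, |FN x| ≤ CN * x ^ 3) ∧
      (∀ xb ∈ Icc (0 : ℝ) δN, ∃ xh ∈ Icc (0 : ℝ) xb,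
        (xh, FN xh) ∈ U ∧ (xb, FN xb) = Φ (xh, FN xh)) := by
  have hN0 : ((N : ℕ) : WithTop ℕ∞) ≠ 0 := by
    simpa using (by omega : N ≠ 0)
  have hN1 : (1 : WithTop ℕ∞) ≤ N := by exact_mod_cast hN
  set x : ℝ → ℝ := fun s => (Γ s).1 with hx
  have hxN : ContDiffAt ℝ N x 0 := hΓ.fst
  have hx0 : x 0 = 0 := by simp [hx, hΓ0]
  have hfd : HasFDerivAt x ((ContinuousLinearEquiv.refl ℝ ℝ : ℝ ≃L[ℝ] ℝ) : ℝ →L[ℝ] ℝ) 0 := by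
    refine hd.hasFDerivAt.congr_fderiv ?_
    ext
    simp
  obtain ⟨g, hg, hgr, hgl⟩ : ∃ g : ℝ → ℝ, ContDiffAt ℝ N g 0 ∧ (∀ᶠ t in 𝓝 (0 : ℝ), x (g t) = t) ∧
      ∀ᶠ s in 𝓝 (0 : ℝ), g (x s) = s := by
    have hs : HasStrictFDerivAt x ((ContinuousLinearEquiv.refl ℝ ℝ : ℝ ≃L[ℝ] ℝ) : ℝ →L[ℝ] ℝ) 0 :=
      hxN.hasStrictFDerivAt' hfd hN0
    refine ⟨hxN.localInverse hfd hN0, ?_, ?_, hs.eventually_left_inverse⟩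
    · simpa only [hx0] using hxN.to_localInverse hfd hN0
    · have h := hs.eventually_right_inverse
      rw [hx0] at h
      exact h
  have hg0 : g 0 = 0 := by
    have := hgl.self_of_nhds
    rwa [hx0] at this
  have hdx : ∀ᶠ s in 𝓝 (0 : ℝ), DifferentiableAt ℝ x s ∧ 1 / 2 < deriv x s := by
    have h1 : ContDiffAt ℝ 1 x 0 := hxN.of_le hN1
    have h2 : ContinuousAt (deriv x) 0 := by
      have : deriv x = fun t => fderiv ℝ x t 1 := by ext t; simp
      rw [this]
      exact ((h1.fderiv_right (m := 0) (by simp)).continuousAt).clm_apply continuousAt_const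
    have h3 : deriv x 0 = 1 := hd.deriv
    filter_upwards [h1.eventually (by simp),
      h2.eventually (lt_mem_nhds (by rw [h3]; norm_num : (1 / 2 : ℝ) < deriv x 0))] with s hs hs'
    exact ⟨hs.differentiableAt (by simp), hs'⟩
  have hUΓ : ∀ᶠ s in 𝓝 (0 : ℝ), Γ s ∈ U := by
    have := hΓ.continuousAt
    exact this.eventually (by rw [hΓ0]; exact hU)
  obtain ⟨ε₁, hε₁, H₁⟩ := Metric.eventually_nhds_iff_ball.1 ((hgl.and hdx).and hUΓ)
  obtain ⟨ε₂, hε₂, H₂⟩ := eventually_nhdsGT_exists (hy.and hinv)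
  have hball : Metric.ball (0 : ℝ) ε₁ = Ioo (-ε₁) ε₁ := by
    rw [Real.ball_eq_Ioo, zero_sub, zero_add]
  rw [hball] at H₁
  have hmono : ∀ s ∈ Ioo (-ε₁) ε₁, ∀ s' ∈ Ioo (-ε₁) ε₁, s ≤ s' → (s' - s) / 2 ≤ x s' - x s := by
    intro s hs s' hs' hss
    have hm : MonotoneOn (fun s => x s - s / 2) (Ioo (-ε₁) ε₁) := by
      have hder : ∀ t ∈ Ioo (-ε₁) ε₁, HasDerivAt (fun s => x s - s / 2) (deriv x t - 1 / 2) t :=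
        fun t ht => (H₁ t ht).1.2.1.hasDerivAt.sub ((hasDerivAt_id t).div_const 2)
      refine monotoneOn_of_deriv_nonneg (convex_Ioo _ _)
        (fun t ht => (hder t ht).continuousAt.continuousWithinAt)
        (fun t ht => (hder t (interior_subset ht)).differentiableAt.differentiableWithinAt)
        (fun t ht => ?_)
      rw [(hder t (interior_subset ht)).deriv]
      linarith [(H₁ t (interior_subset ht)).1.2.2]
    have := hm hs hs' hss
    simp only at this
    linarith
  have hgmem : ∀ᶠ t in 𝓝 (0 : ℝ), g t ∈ Ioo (-min ε₁ ε₂) (min ε₁ ε₂) := by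
    refine hg.continuousAt.eventually ?_
    rw [hg0]
    have : 0 < min ε₁ ε₂ := lt_min hε₁ hε₂
    exact Ioo_mem_nhds (by linarith) this
  have hF : ContDiffAt ℝ N (fun t => (Γ (g t)).2) 0 := by
    have : ContDiffAt ℝ N (fun t => Γ (g t)) 0 :=
      ContDiffAt.comp (0 : ℝ) (g := Γ) (by rw [hg0]; exact hΓ) hg
    exact this.snd
  obtain ⟨δ, hδ, H⟩ := Metric.eventually_nhds_iff_ball.1
    ((hgr.and hgmem).and (hF.eventually (by simp)))
  have hmem : ∀ t ∈ Icc (0 : ℝ) (δ / 2), t ∈ Metric.ball (0 : ℝ) δ := fun t ht => by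
    rw [mem_ball_zero_iff, Real.norm_eq_abs, abs_of_nonneg ht.1]
    linarith [ht.2]
  have hzero : (0 : ℝ) ∈ Ioo (-ε₁) ε₁ := ⟨by linarith, hε₁⟩
  have hgt : ∀ t ∈ Icc (0 : ℝ) (δ / 2), g t ∈ Ioo (-ε₁) ε₁ ∧ 0 ≤ g t ∧ g t < ε₂ ∧ g t ≤ 2 * t ∧
      x (g t) = t := fun t ht => by
    obtain ⟨⟨h1, h2⟩, -⟩ := H t (hmem t ht)
    have h3 : g t ∈ Ioo (-ε₁) ε₁ :=
      ⟨by linarith [h2.1, min_le_left ε₁ ε₂], by linarith [h2.2, min_le_left ε₁ ε₂]⟩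
    have h4 : 0 ≤ g t := by
      by_contra! hneg
      have := hmono _ h3 0 hzero hneg.le
      rw [h1, hx0] at this
      linarith [ht.1]
    have h5 := hmono 0 hzero _ h3 h4
    rw [h1, hx0] at h5
    exact ⟨h3, h4, by linarith [h2.2, min_le_right ε₁ ε₂], by linarith, h1⟩
  refine ⟨δ / 2, by positivity, 8 * C + 1, by positivity, fun t => (Γ (g t)).2,
    fun t ht => (H t (hmem t ht)).2.contDiffWithinAt, fun t ht => ?_, fun t ht => ?_⟩
  · obtain ⟨-, h0, h2, h3, -⟩ := hgt t ht
    have ht0 := ht.1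
    change |(Γ (g t)).2| ≤ (8 * C + 1) * t ^ 3
    rcases h0.eq_or_lt with h0 | h0
    · rw [← h0, hΓ0, Prod.snd_zero, abs_zero]
      positivity
    · refine (H₂ _ ⟨h0, h2⟩).1.trans ?_
      calc C * g t ^ 3 ≤ C * (2 * t) ^ 3 := by gcongr
        _ = 8 * C * t ^ 3 := by ring
        _ ≤ (8 * C + 1) * t ^ 3 := by gcongr; linarith
  · obtain ⟨h1, h0, h2, -, h4⟩ := hgt t ht
    rcases h0.eq_or_lt with h0 | h0
    · have ht0 : t = 0 := by rw [← h4, ← h0, hx0]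
      subst ht0
      have h00 : ((0, (Γ (g 0)).2) : ℝ × ℝ) = 0 := by rw [hg0, hΓ0]; rfl
      exact ⟨0, ⟨le_rfl, le_rfl⟩, by rw [h00]; exact mem_of_mem_nhds hU, by rw [h00, hΦ0]⟩
    · obtain ⟨-, hψ0, hψ1, hΓψ⟩ := H₂ _ ⟨h0, h2⟩
      have hψm : ψ (g t) ∈ Ioo (-ε₁) ε₁ := ⟨by linarith, hψ1.trans_lt h1.2⟩
      obtain ⟨⟨hinvψ, -⟩, hUψ⟩ := H₁ _ hψm
      have hpt : (x (ψ (g t)), (Γ (g (x (ψ (g t))))).2) = Γ (ψ (g t)) := by rw [hinvψ]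
      have hpt' : (t, (Γ (g t)).2) = Γ (g t) := Prod.ext h4.symm rfl
      refine ⟨x (ψ (g t)), ⟨?_, ?_⟩, by rw [hpt]; exact hUψ, by rw [hpt, hpt']; exact hΓψ⟩
      · have := hmono 0 hzero _ hψm hψ0.le
        rw [hx0] at this
        linarith
      · have := hmono _ hψm _ h1 hψ1
        rw [h4] at this
        linarith

end Curve

section Translate
theorem eq_zero_of_isBigO_pow_succ {F : Type*} [NormedAddCommGroup F] {e : ℝ → F} {k : ℕ}
    (h : e =O[𝓝 0] fun s : ℝ => s ^ (k + 1)) : e 0 = 0 := by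
  obtain ⟨C, hC⟩ := h.bound
  simpa using hC.self_of_nhds

variable {F : Type} [NormedAddCommGroup F] [NormedSpace ℝ F]

/-- The two-jet at `0` of a curve which agrees with `(σ - q σ ^ 2) • v` to third order. -/
theorem jet_of_isBigO {κ : ℝ → F} {q : ℝ} {v : F} (hκ : ContDiffAt ℝ ∞ κ 0)
    (h : (fun σ : ℝ => κ σ - (σ - q * σ ^ 2) • v) =O[𝓝 0] fun σ : ℝ => σ ^ 3) :
    κ 0 = 0 ∧ deriv κ 0 = v ∧ deriv (deriv κ) 0 = (-(2 * q)) • v := by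
  set e : ℝ → F := fun σ => κ σ - (σ - q * σ ^ 2) • v with he
  have hp : ∀ σ : ℝ, HasDerivAt (fun σ : ℝ => (σ - q * σ ^ 2) • v) ((1 - 2 * q * σ) • v) σ := by
    intro σ
    refine HasDerivAt.smul_const ?_ v
    exact ((hasDerivAt_id σ).sub ((hasDerivAt_pow 2 σ).const_mul q)).congr_deriv (by
      simp; ring)
  have hp2 : HasDerivAt (fun σ : ℝ => (1 - 2 * q * σ) • v) ((-(2 * q)) • v) 0 := by
    refine HasDerivAt.smul_const ?_ v
    exact ((hasDerivAt_const (0 : ℝ) (1 : ℝ)).sub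
      ((hasDerivAt_id (0 : ℝ)).const_mul (2 * q))).congr_deriv (by simp)
  have hsm : ContDiffAt ℝ ∞ e 0 := hκ.sub (by fun_prop)
  have h1 : deriv e =O[𝓝 0] fun s : ℝ => s ^ (1 + 1) := (taylor_of_isBigO 2).1 e hsm h
  have h2 : deriv (deriv e) =O[𝓝 0] fun s : ℝ => s ^ (0 + 1) :=
    (taylor_of_isBigO 1).1 _ hsm.deriv_infty h1
  have hde : deriv κ =ᶠ[𝓝 0] fun σ => deriv e σ + (1 - 2 * q * σ) • v := by
    filter_upwards [hsm.eventually_differentiableAt] with σ hσ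
    have : κ = fun σ => e σ + (σ - q * σ ^ 2) • v := by ext σ; simp [he]
    rw [this]
    exact (hσ.hasDerivAt.add (hp σ)).deriv
  have hd0 : deriv e 0 = 0 := eq_zero_of_isBigO_pow_succ h1
  refine ⟨?_, ?_, ?_⟩
  · have := eq_zero_of_isBigO_pow_succ (k := 2) h
    simpa [he] using this
  · rw [hde.eq_of_nhds, hd0]
    simp
  · rw [hde.deriv_eq]
    refine ((hsm.deriv_infty.differentiableAt (by simp)).hasDerivAt.add hp2).deriv.trans ?_
    rw [eq_zero_of_isBigO_pow_succ h2, zero_add]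

/-- Translating `Φ` along a curve `κ` and subtracting a curve `γ` produces a flat germ as soon as
`Φ ∘ κ` and `γ` agree to high order. -/
theorem flatGerm_translate {Φ : F → F} {κ γ : ℝ → F} {K : ℝ} {M : ℕ}
    (hΦ : ContDiffAt ℝ ∞ Φ 0) (hL : ∀ v, ‖fderiv ℝ Φ 0 v‖ ≤ ‖v‖) (hK0 : 0 ≤ K)
    (hK : ∀ᶠ p in 𝓝 (0 : F), ‖fderiv ℝ Φ p - fderiv ℝ Φ 0‖ ≤ K * ‖p‖)
    (hκ : ContDiffAt ℝ ∞ κ 0) (hγ : ContDiffAt ℝ ∞ γ 0) (hκ0 : κ 0 = 0)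
    (hκ1 : ‖deriv κ 0‖ < 2) (hκ2 : ‖deriv (deriv κ) 0‖ < 3) (hγ2 : ‖deriv (deriv γ) 0‖ < 1)
    (hM : (fun σ => Φ (κ σ) - γ σ) =O[𝓝 0] fun σ : ℝ => σ ^ M) :
    FlatGerm (9 * K + 4) M (fun p : ℝ × F => Φ (κ p.1 + p.2) - γ p.1) := by
  have hq0 : κ (0 : ℝ × F).1 + (0 : ℝ × F).2 = 0 := by simp [hκ0]
  have hq : ContDiffAt ℝ ∞ (fun p : ℝ × F => κ p.1 + p.2) 0 :=
    (ContDiffAt.comp (0 : ℝ × F) (g := κ) hκ contDiffAt_fst).add contDiffAt_snd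
  have hqt : Tendsto (fun p : ℝ × F => κ p.1 + p.2) (𝓝 0) (𝓝 0) := by
    simpa only [ContinuousAt, hq0] using hq.continuousAt
  have hder : ∀ᶠ p in 𝓝 (0 : ℝ × F), ∀ h : ℝ × F,
      fderiv ℝ (fun p : ℝ × F => Φ (κ p.1 + p.2) - γ p.1) p h =
        fderiv ℝ Φ (κ p.1 + p.2) (h.1 • deriv κ p.1 + h.2) - h.1 • deriv γ p.1 := by
    have hΦe : ∀ᶠ p in 𝓝 (0 : ℝ × F), DifferentiableAt ℝ Φ (κ p.1 + p.2) :=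
      hqt.eventually hΦ.eventually_differentiableAt
    have hκe : ∀ᶠ p in 𝓝 (0 : ℝ × F), DifferentiableAt ℝ κ p.1 :=
      continuousAt_fst.eventually hκ.eventually_differentiableAt
    have hγe : ∀ᶠ p in 𝓝 (0 : ℝ × F), DifferentiableAt ℝ γ p.1 :=
      continuousAt_fst.eventually hγ.eventually_differentiableAt
    filter_upwards [hΦe, hκe, hγe] with p h1 h2 h3 h
    have hκ' : HasFDerivAt (fun p : ℝ × F => κ p.1) _ p :=
      h2.hasFDerivAt.comp p hasFDerivAt_fst
    have hγ' : HasFDerivAt (fun p : ℝ × F => γ p.1) _ p :=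
      h3.hasFDerivAt.comp p hasFDerivAt_fst
    have hΦ' : HasFDerivAt (fun p : ℝ × F => Φ (κ p.1 + p.2)) _ p :=
      HasFDerivAt.comp (g := Φ) p h1.hasFDerivAt (hκ'.add hasFDerivAt_snd)
    have hG : fderiv ℝ (fun p : ℝ × F => Φ (κ p.1 + p.2) - γ p.1) p = _ := (hΦ'.sub hγ').fderiv
    rw [hG]
    simp
  refine ⟨?_, ?_, ?_, ?_⟩
  · refine (ContDiffAt.comp (0 : ℝ × F) (g := Φ) ?_ hq).sub
      (ContDiffAt.comp (0 : ℝ × F) (g := γ) hγ contDiffAt_fst)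
    rw [hq0]; exact hΦ
  · simpa using hM
  · intro w
    rw [hder.self_of_nhds, hq0]
    simpa using hL w
  · have e1 := (continuousAt_fst (X := ℝ) (Y := F) (p := 0)).eventually
      (eventually_norm_sub_le_of_deriv hκ hκ1)
    have e2 := (continuousAt_fst (X := ℝ) (Y := F) (p := 0)).eventually
      (eventually_norm_sub_le_of_deriv hκ.deriv_infty hκ2)
    have e3 := (continuousAt_fst (X := ℝ) (Y := F) (p := 0)).eventually
      (eventually_norm_sub_le_of_deriv hγ.deriv_infty hγ2)
    have e4 : ∀ᶠ p in 𝓝 (0 : ℝ × F), ‖fderiv ℝ Φ (κ p.1 + p.2) - fderiv ℝ Φ 0‖ ≤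
        K * ‖κ p.1 + p.2‖ := hqt.eventually hK
    filter_upwards [hder, e1, e2, e3, e4] with p hp ⟨h1, h1'⟩ ⟨_, h2⟩ ⟨_, h3⟩ h4
    have hσ : |p.1| ≤ ‖p‖ := norm_fst_le p
    rw [hκ0, sub_zero] at h1'
    have hqn : ‖κ p.1 + p.2‖ ≤ 3 * ‖p‖ :=
      (norm_add_le _ _).trans (by linarith [norm_snd_le p])
    refine ContinuousLinearMap.opNorm_le_bound _ (by positivity) fun h => ?_
    have hh : |h.1| ≤ ‖h‖ := norm_fst_le h
    have hu : ‖h.1 • deriv κ p.1 + h.2‖ ≤ 3 * ‖h‖ := by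
      refine (norm_add_le _ _).trans ?_
      rw [norm_smul, Real.norm_eq_abs]
      have : |h.1| * ‖deriv κ p.1‖ ≤ ‖h‖ * 2 := by gcongr
      linarith [norm_snd_le h]
    have key : (fderiv ℝ (fun p : ℝ × F => Φ (κ p.1 + p.2) - γ p.1) p -
        fderiv ℝ (fun p : ℝ × F => Φ (κ p.1 + p.2) - γ p.1) 0) h =
        (fderiv ℝ Φ (κ p.1 + p.2) - fderiv ℝ Φ 0) (h.1 • deriv κ p.1 + h.2) +
          fderiv ℝ Φ 0 (h.1 • (deriv κ p.1 - deriv κ 0)) -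
          h.1 • (deriv γ p.1 - deriv γ 0) := by
      rw [_root_.sub_apply, hp, hder.self_of_nhds, hq0, _root_.sub_apply]
      simp only [map_add, map_smul, map_sub, smul_sub, Prod.fst_zero]
      abel
    rw [key]
    have t1 : ‖(fderiv ℝ Φ (κ p.1 + p.2) - fderiv ℝ Φ 0) (h.1 • deriv κ p.1 + h.2)‖ ≤
        K * (3 * ‖p‖) * (3 * ‖h‖) :=
      (ContinuousLinearMap.le_opNorm _ _).trans
        (mul_le_mul (h4.trans (by gcongr)) hu (norm_nonneg _) (by positivity))
    have t2 : ‖fderiv ℝ Φ 0 (h.1 • (deriv κ p.1 - deriv κ 0))‖ ≤ ‖h‖ * (3 * ‖p‖) := by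
      refine (hL _).trans ?_
      rw [norm_smul, Real.norm_eq_abs]
      exact mul_le_mul hh (h2.trans (by gcongr)) (norm_nonneg _) (norm_nonneg _)
    have t3 : ‖h.1 • (deriv γ p.1 - deriv γ 0)‖ ≤ ‖h‖ * (1 * ‖p‖) := by
      rw [norm_smul, Real.norm_eq_abs]
      exact mul_le_mul hh (h3.trans (by gcongr)) (norm_nonneg _) (norm_nonneg _)
    refine (norm_sub_le _ _).trans ?_
    have := norm_add_le ((fderiv ℝ Φ (κ p.1 + p.2) - fderiv ℝ Φ 0) (h.1 • deriv κ p.1 + h.2))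
      (fderiv ℝ Φ 0 (h.1 • (deriv κ p.1 - deriv κ 0)))
    nlinarith

end Translate

section FormalSolution

theorem isBigO_pow_succ_of_isLittleO {F : Type*} [NormedAddCommGroup F] [NormedSpace ℝ F]
    {e : ℝ → F} {k : ℕ} (he : ContDiffAt ℝ ∞ e 0) (h : e =o[𝓝 0] fun s : ℝ => s ^ k) :
    e =O[𝓝 0] fun s : ℝ => s ^ (k + 1) := by
  obtain ⟨c, hc⟩ := (taylor_of_isBigO k).2 e he h.isBigO
  have h1 : (fun s : ℝ => s ^ k • c) =o[𝓝 0] fun s : ℝ => s ^ k := by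
    have h2 : (fun s : ℝ => s ^ (k + 1)) =o[𝓝 0] fun s : ℝ => s ^ k :=
      isLittleO_pow_pow (Nat.lt_succ_self k)
    simpa using h.sub (hc.trans_isLittleO h2)
  have hc0 : c = 0 := by
    by_contra hne
    have hpos : 0 < ‖c‖ := norm_pos_iff.2 hne
    have h3 := (h1.def (half_pos hpos)).filter_mono (nhdsWithin_le_nhds (s := Ioi 0))
    obtain ⟨s, hs, hs0⟩ := (h3.and self_mem_nhdsWithin).exists
    have hs0' : 0 < |s| ^ k := pow_pos (abs_pos.2 (ne_of_gt hs0)) k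
    rw [norm_smul, norm_pow, Real.norm_eq_abs] at hs
    nlinarith
  simpa [hc0] using hc

theorem isBigO_mul_of_continuousAt {a : ℝ → ℝ} (ha : ContinuousAt a 0) (k : ℕ) :
    (fun s : ℝ => s ^ k * a s) =O[𝓝 0] fun s : ℝ => s ^ k := by
  simpa using (isBigO_refl (fun s : ℝ => s ^ k) (𝓝 0)).mul (ha.isBigO_one ℝ)

/-- The inner dynamics `σ - σ ^ 2 + σ ^ 3 a(σ)`. -/
def innerMap (a : ℝ → ℝ) (σ : ℝ) : ℝ := σ * (1 - σ + σ ^ 2 * a σ)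

/-- The graph `(σ, σ ^ 3 b(σ))`. -/
def cubicCurve (b : ℝ → ℝ) (σ : ℝ) : ℝ × ℝ := (σ, σ ^ 3 * b σ)

variable {a b : ℝ → ℝ}

theorem innerMap_zero : innerMap a 0 = 0 := by simp [innerMap]

theorem cubicCurve_zero : cubicCurve b 0 = 0 := by simp [cubicCurve]

theorem ContDiff.innerMap (ha : ContDiff ℝ ∞ a) : ContDiff ℝ ∞ (innerMap a) := by
  unfold _root_.innerMap
  fun_prop

theorem ContDiff.cubicCurve (hb : ContDiff ℝ ∞ b) : ContDiff ℝ ∞ (cubicCurve b) := by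
  unfold _root_.cubicCurve
  fun_prop

theorem tendsto_innerMap (ha : ContDiff ℝ ∞ a) : Tendsto (innerMap a) (𝓝 0) (𝓝 0) := by
  simpa [innerMap_zero] using ha.innerMap.continuous.tendsto 0

theorem tendsto_cubicCurve (hb : ContDiff ℝ ∞ b) : Tendsto (cubicCurve b) (𝓝 0) (𝓝 0) := by
  simpa [cubicCurve_zero] using hb.cubicCurve.continuous.tendsto 0

theorem innerMap_pow_sub_isLittleO (ha : ContDiff ℝ ∞ a) (k : ℕ) :
    (fun σ => innerMap a σ ^ k - σ ^ k) =o[𝓝 0] fun σ : ℝ => σ ^ k := by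
  have h : Tendsto (fun σ => (1 - σ + σ ^ 2 * a σ) ^ k - 1) (𝓝 0) (𝓝 0) := by
    have : Continuous fun σ => (1 - σ + σ ^ 2 * a σ) ^ k - 1 := by
      have := ha.continuous
      fun_prop
    simpa using this.tendsto 0
  have h2 := (isBigO_refl (fun σ : ℝ => σ ^ k) (𝓝 0)).mul_isLittleO
    ((isLittleO_one_iff ℝ).2 h)
  refine (h2.congr (fun σ => ?_) fun σ => mul_one _)
  simp only [innerMap, mul_pow]
  ring

theorem innerMap_isBigO (ha : ContDiff ℝ ∞ a) : innerMap a =O[𝓝 0] fun σ : ℝ => σ := by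
  have h := innerMap_pow_sub_isLittleO ha 1
  simp only [pow_one] at h
  simpa using h.isBigO.add (isBigO_refl (fun σ : ℝ => σ) (𝓝 0))

theorem cubicCurve_sub_isBigO (hb : ContDiff ℝ ∞ b) :
    (fun σ : ℝ => cubicCurve b σ - σ • ((1 : ℝ), (0 : ℝ))) =O[𝓝 0] fun σ : ℝ => σ ^ 3 := by
  have h := isBigO_mul_of_continuousAt hb.continuous.continuousAt 3
  refine ((isBigO_zero _ _).prod_left h).congr_left fun σ => ?_
  simp [cubicCurve]

theorem cubicCurve_innerMap_sub_isBigO (ha : ContDiff ℝ ∞ a) (hb : ContDiff ℝ ∞ b) :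
    (fun σ : ℝ => cubicCurve b (innerMap a σ) - (σ - 1 * σ ^ 2) • ((1 : ℝ), (0 : ℝ))) =O[𝓝 0]
      fun σ : ℝ => σ ^ 3 := by
  have h1 := isBigO_mul_of_continuousAt ha.continuous.continuousAt 3
  have h2 := ((isBigO_mul_of_continuousAt hb.continuous.continuousAt 3).comp_tendsto
    (tendsto_innerMap ha)).trans ((innerMap_isBigO ha).pow 3)
  refine (h1.prod_left h2).congr_left fun σ => ?_
  ext
  · simp [cubicCurve, innerMap]; ring
  · simp [cubicCurve]

theorem hasStrictDerivAt_cube_mul (hb : ContDiff ℝ ∞ b) :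
    HasStrictDerivAt (fun σ : ℝ => σ ^ 3 * b σ) 0 0 := by
  have h1 : ContDiffAt ℝ ∞ (fun σ : ℝ => σ ^ 3 * b σ) 0 := by fun_prop
  have h2 : HasDerivAt (fun σ : ℝ => σ ^ 3 * b σ) 0 0 :=
    ((hasDerivAt_pow 3 (0 : ℝ)).mul
      ((hb.differentiable (by simp)) 0).hasDerivAt).congr_deriv (by simp)
  exact h1.hasStrictDerivAt' h2 (by simp)

/-- The linear part `(x, y) ↦ (x, -y)`. -/
abbrev flipSnd : ℝ × ℝ →L[ℝ] ℝ × ℝ :=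
  (ContinuousLinearMap.fst ℝ ℝ ℝ).prod (-ContinuousLinearMap.snd ℝ ℝ ℝ)

theorem exists_approx_conjugacy_step {Φ : ℝ × ℝ → ℝ × ℝ} (hΦ : ContDiffAt ℝ ∞ Φ 0)
    (hL : HasStrictFDerivAt Φ flipSnd 0) (ha : ContDiff ℝ ∞ a) (hb : ContDiff ℝ ∞ b) {k : ℕ}
    (h : (fun σ => Φ (cubicCurve b (innerMap a σ)) - cubicCurve b σ) =O[𝓝 0]
      fun σ : ℝ => σ ^ (k + 3)) :
    ∃ a' b' : ℝ → ℝ, ContDiff ℝ ∞ a' ∧ ContDiff ℝ ∞ b' ∧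
      (fun σ => Φ (cubicCurve b' (innerMap a' σ)) - cubicCurve b' σ) =O[𝓝 0]
        fun σ : ℝ => σ ^ (k + 1 + 3) := by
  have smooth : ∀ {a b : ℝ → ℝ}, ContDiff ℝ ∞ a → ContDiff ℝ ∞ b →
      ContDiffAt ℝ ∞ (fun σ => Φ (cubicCurve b (innerMap a σ)) - cubicCurve b σ) 0 := by
    intro a b ha hb
    refine ContDiffAt.sub (ContDiffAt.comp (0 : ℝ) (g := Φ) ?_
      (hb.cubicCurve.comp ha.innerMap).contDiffAt) hb.cubicCurve.contDiffAt
    simpa [innerMap_zero, cubicCurve_zero] using hΦ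
  obtain ⟨c, hc⟩ := (taylor_of_isBigO (k + 3)).2 _ (smooth ha hb) h
  set α : ℝ := -c.1 with hα
  set β : ℝ := c.2 / 2 with hβ
  set a' : ℝ → ℝ := fun σ => a σ + α * σ ^ k with ha'def
  set b' : ℝ → ℝ := fun σ => b σ + β * σ ^ k with hb'def
  have ha' : ContDiff ℝ ∞ a' := by fun_prop
  have hb' : ContDiff ℝ ∞ b' := by fun_prop
  refine ⟨a', b', ha', hb', ?_⟩
  have hsucc : k + 1 + 3 = k + 3 + 1 := by ring
  rw [hsucc]
  refine isBigO_pow_succ_of_isLittleO (smooth ha' hb') ?_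
  have hψ : ∀ σ, innerMap a' σ = innerMap a σ + α * σ ^ (k + 3) := fun σ => by
    simp only [innerMap, ha'def]; ring
  have hO : ∀ r : ℝ, (fun σ : ℝ => r * σ ^ (k + 3)) =O[𝓝 0] fun σ : ℝ => σ ^ (k + 3) :=
    fun r => (isBigO_refl _ _).const_mul_left r
  have hr1 : (fun σ => innerMap a' σ ^ 3 * b (innerMap a' σ) -
      innerMap a σ ^ 3 * b (innerMap a σ)) =o[𝓝 0] fun σ : ℝ => σ ^ (k + 3) := by
    have h1 := (hasStrictDerivAt_cube_mul hb).hasStrictFDerivAt.isLittleO.comp_tendsto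
      ((tendsto_innerMap ha').prodMk_nhds (tendsto_innerMap ha))
    refine IsLittleO.trans_isBigO (h1.congr_left fun σ => ?_) ((hO α).congr_left fun σ => ?_)
    · simp
    · simp [hψ]
  have hr2 : (fun σ => β * (innerMap a' σ ^ (k + 3) - σ ^ (k + 3))) =o[𝓝 0]
      fun σ : ℝ => σ ^ (k + 3) := (innerMap_pow_sub_isLittleO ha' (k + 3)).const_mul_left β
  set r : ℝ → ℝ := fun σ => (innerMap a' σ ^ 3 * b (innerMap a' σ) -
      innerMap a σ ^ 3 * b (innerMap a σ)) +
      β * (innerMap a' σ ^ (k + 3) - σ ^ (k + 3)) with hr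
  have hro : r =o[𝓝 0] fun σ : ℝ => σ ^ (k + 3) := hr1.add hr2
  have hdiff : ∀ σ, cubicCurve b' (innerMap a' σ) - cubicCurve b (innerMap a σ) =
      (α * σ ^ (k + 3), β * σ ^ (k + 3) + r σ) := fun σ => by
    ext
    · simp [cubicCurve, hψ]
    · simp only [cubicCurve, hr, hb'def, Prod.snd_sub]
      ring
  have hdO : (fun σ => cubicCurve b' (innerMap a' σ) - cubicCurve b (innerMap a σ)) =O[𝓝 0]
      fun σ : ℝ => σ ^ (k + 3) :=
    ((hO α).prod_left ((hO β).add hro.isBigO)).congr_left fun σ => (hdiff σ).symm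
  have hlin := (hL.isLittleO.comp_tendsto
    (((tendsto_cubicCurve hb').comp (tendsto_innerMap ha')).prodMk_nhds
      ((tendsto_cubicCurve hb).comp (tendsto_innerMap ha)))).trans_isBigO hdO
  have hrest : (fun σ => ((0 : ℝ), -r σ)) =o[𝓝 0] fun σ : ℝ => σ ^ (k + 3) :=
    (isLittleO_zero _ _).prod_left hro.neg_left
  have hco := hc.trans_isLittleO
    (isLittleO_pow_pow (𝕜 := ℝ) (Nat.lt_succ_self (k + 3)))
  refine ((hlin.add hco).add hrest).congr_left fun σ => ?_
  simp only [Function.comp_apply, flipSnd, hdiff σ]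
  ext
  · simp [cubicCurve, hα]
    ring
  · simp [cubicCurve, hb'def, hβ]
    ring

theorem exists_approx_conjugacy {Φ : ℝ × ℝ → ℝ × ℝ} {μ lam : ℝ} (hΦ : ContDiffAt ℝ ∞ Φ 0)
    (hL : HasStrictFDerivAt Φ flipSnd 0)
    (hform : (fun p : ℝ × ℝ =>
        Φ p - (p.1 + p.1 ^ 2 + μ * p.1 * p.2, -p.2 + lam * p.1 * p.2))
      =O[𝓝 (0 : ℝ × ℝ)] fun p => ‖p‖ ^ 3) (k : ℕ) :
    ∃ a b : ℝ → ℝ, ContDiff ℝ ∞ a ∧ ContDiff ℝ ∞ b ∧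
      (fun σ => Φ (cubicCurve b (innerMap a σ)) - cubicCurve b σ) =O[𝓝 0]
        fun σ : ℝ => σ ^ (k + 3) := by
  induction k with
  | zero =>
    have h0 : ContDiff ℝ ∞ fun _ : ℝ => (0 : ℝ) := contDiff_const
    refine ⟨fun _ => 0, fun _ => 0, h0, h0, ?_⟩
    have h1 := hform.comp_tendsto ((tendsto_cubicCurve h0).comp (tendsto_innerMap h0))
    have h2 : (fun σ : ℝ => ‖cubicCurve (fun _ => 0) (innerMap (fun _ => 0) σ)‖ ^ 3) =O[𝓝 0]
        fun σ : ℝ => σ ^ 3 := by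
      refine IsBigO.pow (IsBigO.norm_left ?_) 3
      refine ((innerMap_isBigO h0).prod_left (isBigO_zero _ _)).congr_left fun σ => ?_
      simp [cubicCurve]
    have h3 : (fun σ : ℝ => ((σ ^ 3 * (σ - 2), 0) : ℝ × ℝ)) =O[𝓝 0] fun σ : ℝ => σ ^ 3 :=
      (isBigO_mul_of_continuousAt (by fun_prop) 3).prod_left (isBigO_zero _ _)
    refine ((h1.trans h2).add h3).congr_left fun σ => ?_
    simp only [Function.comp_apply]
    ext
    · simp [cubicCurve, innerMap]
      ring
    · simp [cubicCurve]
  | succ k ih =>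
    obtain ⟨a, b, ha, hb, h⟩ := ih
    exact exists_approx_conjugacy_step hΦ hL ha hb h

/-- `1 + σ χ'(σ) / χ(σ)` where `χ(σ) = 1 - σ + σ ^ 2 a(σ)`. -/
noncomputable def innerRatio (a : ℝ → ℝ) (σ : ℝ) : ℝ :=
  1 + σ * (deriv (fun σ => 1 - σ + σ ^ 2 * a σ) σ / (1 - σ + σ ^ 2 * a σ))

theorem parabolicPair_innerMap (ha : ContDiff ℝ ∞ a) :
    ParabolicPair (innerMap a) (innerRatio a) := by
  set χ : ℝ → ℝ := fun σ => 1 - σ + σ ^ 2 * a σ with hχ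
  have hχs : ContDiff ℝ ∞ χ := by fun_prop
  have hχ0 : χ 0 = 1 := by simp [hχ]
  have hχd : HasDerivAt χ (-1) 0 :=
    (((hasDerivAt_const (0 : ℝ) (1 : ℝ)).sub (hasDerivAt_id 0)).add
      ((hasDerivAt_pow 2 (0 : ℝ)).mul
        ((ha.differentiable (by simp)) 0).hasDerivAt)).congr_deriv (by simp)
  have hχpos : ∀ᶠ σ in 𝓝 (0 : ℝ), 0 < χ σ :=
    hχs.continuous.continuousAt.eventually (lt_mem_nhds (by rw [hχ0]; norm_num))
  have hq : ContDiffAt ℝ ∞ (fun σ => deriv χ σ / χ σ) 0 :=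
    hχs.contDiffAt.deriv_infty.div hχs.contDiffAt (by rw [hχ0]; norm_num)
  have hsmall : ∀ᶠ σ in 𝓝 (0 : ℝ), σ * a σ < 1 / 2 := by
    have : Continuous fun σ : ℝ => σ * a σ := by
      have := ha.continuous
      fun_prop
    exact this.continuousAt.eventually (gt_mem_nhds (by norm_num))
  refine ⟨ha.innerMap.contDiffAt, ?_, ?_, by simp [innerRatio], ?_, ?_⟩
  · exact contDiffAt_const.add (contDiffAt_id.mul hq)
  · filter_upwards [hχpos.filter_mono nhdsWithin_le_nhds,
      hsmall.filter_mono nhdsWithin_le_nhds, self_mem_nhdsWithin] with σ h1 h2 h3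
    have h3' : 0 < σ := h3
    refine ⟨mul_pos h3 h1, ?_⟩
    simp only [innerMap]
    nlinarith [mul_le_mul_of_nonneg_left h2.le (sq_nonneg σ)]
  · have h : HasDerivAt (innerRatio a) (-1) 0 :=
      (((hasDerivAt_id (0 : ℝ)).mul (hq.differentiableAt (by simp)).hasDerivAt).const_add
        1).congr_deriv (by simp [hχ0, hχd.deriv])
    rw [h.deriv]
    norm_num
  · filter_upwards [hχpos.filter_mono nhdsWithin_le_nhds] with σ h1
    have h2 : HasDerivAt (innerMap a) (1 * χ σ + σ * deriv χ σ) σ :=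
      (hasDerivAt_id σ).mul ((hχs.differentiable (by simp)) σ).hasDerivAt
    rw [h2.deriv]
    change (1 + σ * (deriv χ σ / χ σ)) * (σ * χ σ) = _
    have := h1.ne'
    field_simp

end FormalSolution

section Assembly

theorem hasFDerivAt_of_form {Φ : ℝ × ℝ → ℝ × ℝ} {μ lam : ℝ}
    (hform : (fun p : ℝ × ℝ =>
        Φ p - (p.1 + p.1 ^ 2 + μ * p.1 * p.2, -p.2 + lam * p.1 * p.2))
      =O[𝓝 (0 : ℝ × ℝ)] fun p => ‖p‖ ^ 3) :
    Φ 0 = 0 ∧ HasFDerivAt Φ flipSnd 0 := by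
  constructor
  · obtain ⟨C, hC⟩ := hform.bound
    have := hC.self_of_nhds
    have h0 : Φ 0 = (0, 0) := by simpa [sub_eq_zero] using this
    exact h0
  · have h1 : HasFDerivAt (fun p : ℝ × ℝ =>
        Φ p - (p.1 + p.1 ^ 2 + μ * p.1 * p.2, -p.2 + lam * p.1 * p.2))
        (0 : ℝ × ℝ →L[ℝ] ℝ × ℝ) 0 := by
      refine IsBigO.hasFDerivAt (n := 3) ?_ (by norm_num)
      simpa using hform
    have hx : HasFDerivAt (fun p : ℝ × ℝ => p.1) _ (0 : ℝ × ℝ) := hasFDerivAt_fst (𝕜 := ℝ)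
    have hy : HasFDerivAt (fun p : ℝ × ℝ => p.2) _ (0 : ℝ × ℝ) := hasFDerivAt_snd (𝕜 := ℝ)
    have h2 : HasFDerivAt (fun p : ℝ × ℝ =>
        (p.1 + p.1 ^ 2 + μ * p.1 * p.2, -p.2 + lam * p.1 * p.2)) _ (0 : ℝ × ℝ) :=
      ((hx.add (hx.pow 2)).add ((hx.const_mul μ).mul hy)).prodMk
        (hy.neg.add ((hx.const_mul lam).mul hy))
    have h3 := h1.add h2
    refine (h3.congr_fderiv ?_).congr_of_eventuallyEq (Eventually.of_forall fun p => ?_)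
    · ext <;> simp
    · simp

theorem norm_flipSnd_apply (v : ℝ × ℝ) : ‖flipSnd v‖ = ‖v‖ := by
  simp [Prod.norm_def]

/-- A planar germ with linear part `(x, y) ↦ (x, -y)` which is conjugate to a parabolic
contraction along a smooth curve, up to sufficiently high order, has an invariant curve of class
`C ^ N` close to that curve. -/
theorem exists_invariant_curve {Φ : ℝ × ℝ → ℝ × ℝ} {K : ℝ} (hΦ : ContDiffAt ℝ ∞ Φ 0)
    (hΦL : HasFDerivAt Φ flipSnd 0) (hK0 : 0 ≤ K)
    (hK : ∀ᶠ p in 𝓝 (0 : ℝ × ℝ), ‖fderiv ℝ Φ p - fderiv ℝ Φ 0‖ ≤ K * ‖p‖)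
    {N m : ℕ} (hmN : N + 3 ≤ m) (hm : 2 * prolongConst (N + 1) (9 * K + 4) ≤ m)
    {a b : ℝ → ℝ} (ha : ContDiff ℝ ∞ a) (hb : ContDiff ℝ ∞ b)
    (hab : (fun σ => Φ (cubicCurve b (innerMap a σ)) - cubicCurve b σ) =O[𝓝 0]
      fun σ : ℝ => σ ^ (m + 3)) :
    ∃ e : ℝ → ℝ × ℝ, ContDiffAt ℝ N e 0 ∧ e =O[𝓝 0] (fun σ : ℝ => σ ^ 3) ∧
      ∀ᶠ σ in 𝓝[>] (0 : ℝ), cubicCurve b σ + e σ =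
        Φ (cubicCurve b (innerMap a σ) + e (innerMap a σ)) := by
  have hκs : ContDiff ℝ ∞ fun σ => cubicCurve b (innerMap a σ) :=
    hb.cubicCurve.comp ha.innerMap
  obtain ⟨hκ0, hκ1, hκ2⟩ := jet_of_isBigO hκs.contDiffAt (cubicCurve_innerMap_sub_isBigO ha hb)
  obtain ⟨-, -, hγ2⟩ := jet_of_isBigO (q := 0) (v := ((1 : ℝ), (0 : ℝ))) hb.cubicCurve.contDiffAt
    (by simpa using cubicCurve_sub_isBigO hb)
  have hnorm : ‖((1 : ℝ), (0 : ℝ))‖ = 1 := by simp [Prod.norm_def]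
  have hG : FlatGerm (9 * K + 4) (m + 3) (fun p : ℝ × (ℝ × ℝ) =>
      Φ (cubicCurve b (innerMap a p.1) + p.2) - cubicCurve b p.1) := by
    refine flatGerm_translate (κ := fun σ => cubicCurve b (innerMap a σ)) hΦ
      (fun v => ?_) hK0 hK hκs.contDiffAt hb.cubicCurve.contDiffAt hκ0 ?_ ?_ ?_ hab
    · rw [hΦL.fderiv, norm_flipSnd_apply]
    · rw [hκ1, hnorm]; norm_num
    · rw [hκ2, norm_smul, hnorm]; norm_num
    · rw [hγ2]; simp
  have hψ := parabolicPair_innerMap ha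
  obtain ⟨δ, hδ, f, hf, hfd⟩ :=
    hG.exists_flatDiff (k := N + 1) hψ (by positivity) (by omega) hm le_rfl
  have hfix := hG.eventually_fixed hψ (by omega) hδ hf
  refine ⟨fun σ => if 0 < σ then f σ else 0, ?_, ?_, ?_⟩
  · exact (hfd.contDiffOn (by omega)).contDiffAt (Iio_mem_nhds hδ)
  · refine IsBigO.trans (IsBigO.of_bound 2 ?_) (isBigO_pow_of_le (by omega : 3 ≤ m))
    filter_upwards [Iio_mem_nhds hδ] with σ hσ
    split_ifs with h0
    · have := hf 0 σ ⟨h0, hσ⟩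
      simp only [iter, sub_zero, Nat.cast_zero, zero_add, div_one] at this
      rw [norm_pow, Real.norm_eq_abs, abs_of_pos h0]
      linarith
    · simp
  · filter_upwards [hfix, hψ.contracts, self_mem_nhdsWithin] with σ h1 h2 h3
    simp only [if_pos h2.1, if_pos (show 0 < σ from h3)]
    rw [h1]
    abel

end Assembly

/-- **Assertion 8.** Let `Φ` be a `C^∞` map of the form (2) and let
`N ≥ 100`. Then there exist `δ_N, C_N > 0` and `F_N ∈ C^N([0, δ_N])` such that:
(I) Tangency: `|F_N(x)| ≤ C_N x³` on `[0, δ_N]`;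
(II) Invariance: every `x̄ ∈ [0, δ_N]` admits `x̂ ∈ [0, x̄]` with
`(x̄, F_N(x̄)) = Φ(x̂, F_N(x̂))`. -/
theorem assertion8
    (Φ : ℝ × ℝ → ℝ × ℝ) (U : Set (ℝ × ℝ)) (hU : U ∈ 𝓝 (0 : ℝ × ℝ))
    (hΦ : ContDiffOn ℝ (⊤ : ℕ∞) Φ U)
    (μ lam : ℝ) (hlam : 0 < lam)
    (hform : (fun p : ℝ × ℝ =>
        Φ p - (p.1 + p.1 ^ 2 + μ * p.1 * p.2, -p.2 + lam * p.1 * p.2))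
      =O[𝓝 (0 : ℝ × ℝ)] fun p => ‖p‖ ^ 3)
    (N : ℕ) (hN : 100 ≤ N) :
    ∃ δN > (0 : ℝ), ∃ CN > (0 : ℝ), ∃ FN : ℝ → ℝ,
      ContDiffOn ℝ (N : ℕ∞) FN (Icc 0 δN) ∧
      (∀ x ∈ Icc (0 : ℝ) δN, |FN x| ≤ CN * x ^ 3) ∧
      (∀ xb ∈ Icc (0 : ℝ) δN, ∃ xh ∈ Icc (0 : ℝ) xb,
        (xh, FN xh) ∈ U ∧ (xb, FN xb) = Φ (xh, FN xh)) := by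
  have hΦs : ContDiffAt ℝ ∞ Φ 0 := hΦ.contDiffAt hU
  obtain ⟨hΦ0, hΦL⟩ := hasFDerivAt_of_form hform
  have hΦ' : ContDiffAt ℝ ∞ (fderiv ℝ Φ) 0 := hΦs.fderiv_right (by simp)
  obtain ⟨K, hK0, hK⟩ :=
    (hΦ'.differentiableAt (by simp)).hasFDerivAt.isBigO_sub.exists_nonneg
  simp only [sub_zero] at hK
  obtain ⟨m₀, hm₀⟩ := exists_nat_ge (2 * prolongConst (N + 1) (9 * K + 4))
  have hm : 2 * prolongConst (N + 1) (9 * K + 4) ≤ ((m₀ + N + 3 : ℕ) : ℝ) := by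
    push_cast
    have : (0 : ℝ) ≤ N := N.cast_nonneg
    linarith
  obtain ⟨a, b, ha, hb, hab⟩ :=
    exists_approx_conjugacy hΦs (hΦs.hasStrictFDerivAt' hΦL (by simp)) hform (m₀ + N + 3)
  obtain ⟨e, heN, heO, hinv⟩ :=
    exists_invariant_curve hΦs hΦL hK0 hK.bound (by omega) hm ha hb hab
  have he0 : e 0 = 0 := eq_zero_of_isBigO_pow_succ (k := 2) heO
  have hyO : (fun s => (cubicCurve b s + e s).2) =O[𝓝 0] fun s : ℝ => s ^ 3 :=
    (isBigO_mul_of_continuousAt hb.continuous.continuousAt 3).add heO.prod_left_snd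
  obtain ⟨C, hC, hyC⟩ := hyO.exists_nonneg
  refine exists_graph_of_curve (Γ := fun s => cubicCurve b s + e s) (ψ := innerMap a) hU hΦ0
    (by omega) (((hb.cubicCurve.of_le (by exact_mod_cast le_top)).contDiffAt).add heN)
    (by rw [cubicCurve_zero, he0, add_zero]) ?_ hC ?_ ?_
  · have h1 : HasDerivAt (fun s => (e s).1) 0 0 := by
      have h2 : HasFDerivAt (fun s => (e s).1) (0 : ℝ →L[ℝ] ℝ) 0 := by
        refine IsBigO.hasFDerivAt (n := 3) ?_ (by norm_num)
        simpa using heO.prod_left_fst.norm_right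
      simpa using h2.hasDerivAt
    exact ((hasDerivAt_id (0 : ℝ)).add h1).congr_deriv (add_zero 1)
  · filter_upwards [hyC.bound.filter_mono nhdsWithin_le_nhds, self_mem_nhdsWithin] with s hs h0
    rwa [norm_pow, Real.norm_eq_abs, Real.norm_eq_abs, abs_of_pos (show 0 < s from h0)] at hs
  · filter_upwards [hinv, (parabolicPair_innerMap ha).contracts] with s h1 h2
    exact ⟨h2.1, by nlinarith [sq_nonneg s], h1⟩
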